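/- Let G be the Artin group of a spherical type Coxeter graph of rank n = |S|. Then the cohomological dimension of G equals n. -/

import Mathlib

def altFree {B : Type*} (s t : B) (m : ℕ) : FreeGroup B :=
  (List.map FreeGroup.of (CoxeterSystem.alternatingWord s t m)).prod

def artinRels {B : Type*} (M : CoxeterMatrix B) : Set (FreeGroup B) :=
  {r | ∃ s t : B, s ≠ t ∧ M s t ≠ 0 ∧
    r = altFree s t (M s t) * (altFree t s (M s t))⁻¹}

abbrev ArtinGroup {B : Type*} (M : CoxeterMatrix B) : Type _ :=
  PresentedGroup (artinRels M)

/-- The cohomological dimension of a group `G`: the supremum of the degrees in which some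
`ℤG`-module has nonvanishing group cohomology. -/
noncomputable def cohomDim (G : Type) [Group G] : ℕ∞ :=
  sSup {n : ℕ∞ | ∃ m : ℕ, (m : ℕ∞) = n ∧
    ∃ A : Rep ℤ G, Nontrivial (groupCohomology A m)}

namespace CoxeterSystem

section Geometric

open Polynomial.Chebyshev Module

variable {B : Type*}

/-- Twice the cosine form of a Coxeter matrix, as a linear functional for each simple root. -/
noncomputable def corootForm (M : CoxeterMatrix B) (i : B) : Dual ℝ (B →₀ ℝ) :=
  Finsupp.linearCombination ℝ fun j => -2 * Real.cos (Real.pi / M i j)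

theorem corootForm_single (M : CoxeterMatrix B) (i j : B) :
    corootForm M i (Finsupp.single j 1) = -2 * Real.cos (Real.pi / M i j) := by
  simp [corootForm]

theorem corootForm_self (M : CoxeterMatrix B) (i : B) :
    corootForm M i (Finsupp.single i 1) = 2 := by
  simp [corootForm_single]

/-- The reflection of the geometric representation attached to a generator. -/
noncomputable def geomReflection (M : CoxeterMatrix B) (i : B) : (B →₀ ℝ) ≃ₗ[ℝ] (B →₀ ℝ) :=
  reflection (corootForm_self M i)

theorem geom_trace (M : CoxeterMatrix B) (i j : B) :
    corootForm M i (Finsupp.single j 1) * corootForm M j (Finsupp.single i 1) - 2 =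
      2 * Real.cos (2 * (Real.pi / M i j)) := by
  rw [corootForm_single, corootForm_single, M.symmetric j i, Real.cos_two_mul]
  ring

theorem geomReflection_isLiftable (M : CoxeterMatrix B) :
    M.IsLiftable (geomReflection M) := by
  intro i j
  by_cases hij : i = j
  · subst hij
    rw [M.diagonal, pow_one, geomReflection]
    exact LinearEquiv.ext fun x => by
      rw [LinearEquiv.mul_apply, involutive_reflection]; rfl
  rcases Nat.eq_zero_or_pos (M i j) with h0 | hpos
  · rw [h0, pow_zero]
  have h1 : M i j ≠ 1 := fun h => M.off_diagonal i j hij h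
  refine LinearEquiv.ext fun z => ?_
  have key := reflection_mul_reflection_pow_apply (corootForm_self M i) (corootForm_self M j)
    (M i j) z (2 * Real.cos (2 * (Real.pi / M i j)))
    (by rw [← geom_trace M i j])
  rw [geomReflection, geomReflection, key]
  obtain h2 | h3 : M i j = 2 ∨ 3 ≤ M i j := by omega
  · have hc : corootForm M j (Finsupp.single i 1) = 0 := by
      rw [corootForm_single, M.symmetric j i, h2]; simp
    have hc' : corootForm M i (Finsupp.single j 1) = 0 := by
      rw [corootForm_single, h2]; simp
    have ht : 2 * Real.cos (2 * (Real.pi / M i j)) = -2 := by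
      rw [h2]; push_cast; rw [mul_div_cancel₀ _ (by norm_num)]; simp
    rw [ht, hc, hc', h2]
    norm_num [S_neg_one]
    module
  · set θ : ℝ := 2 * (Real.pi / M i j) with hθ
    have hm : (0 : ℝ) < M i j := by exact_mod_cast hpos
    have h3' : (3 : ℝ) ≤ M i j := by exact_mod_cast h3
    have hmθ : M i j * θ = 2 * Real.pi := by rw [hθ]; field_simp
    have hs : Real.sin θ ≠ 0 := by
      apply ne_of_gt
      apply Real.sin_pos_of_pos_of_lt_pi
      · positivity
      · nlinarith [Real.pi_pos]
    have hS : ∀ n : ℤ, (S ℝ n).eval (2 * Real.cos θ) = Real.sin ((n + 1) * θ) / Real.sin θ :=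
      fun n => by rw [eq_div_iff hs, S_two_mul_real_cos]
    obtain ⟨p, hp | hp⟩ := Nat.even_or_odd' (M i j)
    · have e1 : ((M i j : ℤ) - 2) / 2 = p - 1 := by omega
      have e2 : ((M i j : ℤ) - 1) / 2 = p - 1 := by omega
      have hz : (S ℝ ((p : ℤ) - 1)).eval (2 * Real.cos θ) = 0 := by
        rw [hS]
        have : (((p : ℤ) - 1 : ℤ) + 1 : ℝ) * θ = Real.pi := by
          rw [hp] at hmθ; push_cast at hmθ ⊢; linarith
        rw [this]; simp
      rw [e1, e2, hz]
      simp
    · have e1 : ((M i j : ℤ) - 2) / 2 = p - 1 := by omega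
      have e2 : ((M i j : ℤ) - 1) / 2 = p := by omega
      have e3 : ((M i j : ℤ) - 3) / 2 = p - 1 := by omega
      have hz : (S ℝ (p : ℤ)).eval (2 * Real.cos θ) +
          (S ℝ ((p : ℤ) - 1)).eval (2 * Real.cos θ) = 0 := by
        rw [hS, hS, ← add_div]
        have : (((p : ℤ) - 1 : ℤ) + 1 : ℝ) * θ = 2 * Real.pi - (((p : ℤ) : ℝ) + 1) * θ := by
          rw [hp] at hmθ; push_cast at hmθ ⊢; linarith
        rw [this, Real.sin_two_pi_sub]; simp
      have e4 : (M i j : ℤ) / 2 = p := by omega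
      rw [e1, e2, e3, e4, hz]
      simp

variable {W : Type*} [Group W] {M : CoxeterMatrix B} (cs : CoxeterSystem M W)

/-- The order of the product of two simple reflections is divisible by the matrix entry. -/
theorem dvd_of_simple_mul_simple_pow_eq_one {i j : B} {k : ℕ}
    (h : (cs.simple i * cs.simple j) ^ k = 1) : M i j ∣ k := by
  by_cases hij : i = j
  · subst hij; simp
  have h1 : M i j ≠ 1 := fun h => M.off_diagonal i j hij h
  have hg : (geomReflection M i * geomReflection M j) ^ k = 1 := by
    have := congrArg (cs.lift ⟨_, geomReflection_isLiftable M⟩) h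
    simpa using this
  have key := reflection_mul_reflection_pow_apply_self (corootForm_self M i) (corootForm_self M j)
    k (2 * Real.cos (2 * (Real.pi / M i j)))
    (by rw [← geom_trace M i j])
  have hg' : (geomReflection M i * geomReflection M j) ^ k = _ := hg
  rw [geomReflection, geomReflection] at hg'
  rw [hg'] at key
  have ki := DFunLike.congr_fun key i
  have kj := DFunLike.congr_fun key j
  have hcj : corootForm M j (Finsupp.single i 1) = -2 * Real.cos (Real.pi / M i j) := by
    rw [corootForm_single, M.symmetric j i]
  rw [hcj] at ki kj
  simp [hij, Ne.symm hij] at ki kj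
  rcases Nat.eq_zero_or_pos (M i j) with h0 | hpos
  · rw [h0] at ki kj ⊢
    simp [S_eval_two] at ki kj
    simp [kj]
  obtain h2 | h3 : M i j = 2 ∨ 3 ≤ M i j := by omega
  · have ht : 2 * Real.cos (2 * (Real.pi / M i j)) = -2 := by
      rw [h2]; push_cast; rw [mul_div_cancel₀ _ (by norm_num)]; simp
    rw [ht, S_eval_neg_two, S_eval_neg_two] at ki
    rw [h2, ← even_iff_two_dvd]
    by_contra ho
    rw [Nat.not_even_iff_odd] at ho
    have ho' : Odd (k : ℤ) := by exact_mod_cast ho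
    rw [Int.negOnePow_odd _ ho', Int.negOnePow_even _ (ho'.sub_odd odd_one)] at ki
    push_cast at ki
    linarith
  · set θ : ℝ := 2 * (Real.pi / M i j) with hθ
    have hm : (0 : ℝ) < M i j := by exact_mod_cast hpos
    have h3' : (3 : ℝ) ≤ M i j := by exact_mod_cast h3
    have hmθ : M i j * θ = 2 * Real.pi := by rw [hθ]; field_simp
    have hs : Real.sin θ ≠ 0 := by
      apply ne_of_gt
      apply Real.sin_pos_of_pos_of_lt_pi
      · positivity
      · nlinarith [Real.pi_pos]
    have hS : ∀ n : ℤ, (S ℝ n).eval (2 * Real.cos θ) = Real.sin ((n + 1) * θ) / Real.sin θ :=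
      fun n => by rw [eq_div_iff hs, S_two_mul_real_cos]
    have hc : Real.cos (Real.pi / M i j) ≠ 0 := by
      apply ne_of_gt
      apply Real.cos_pos_of_mem_Ioo
      constructor
      · have : 0 < Real.pi / M i j := by positivity
        linarith [Real.pi_pos]
      · nlinarith [Real.pi_pos]
    have kj' : (S ℝ ((k : ℤ) - 1)).eval (2 * Real.cos θ) = 0 := by
      rcases kj with h | h
      · exact h
      · exact absurd (by linarith) hc
    rw [kj'] at ki
    rw [hS, div_eq_zero_iff, or_iff_left hs] at kj'
    rw [hS, eq_comm, add_zero, div_eq_one_iff_eq hs] at ki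
    push_cast at ki kj'
    have hk : Real.cos (k * θ) = 1 := by
      rw [sub_add_cancel] at kj'
      rw [add_mul, Real.sin_add, kj', one_mul, zero_mul, zero_add] at ki
      exact mul_right_cancel₀ hs (by rw [ki, one_mul])
    rw [Real.cos_eq_one_iff] at hk
    obtain ⟨n, hn⟩ := hk
    have : (n : ℝ) * M i j = k := by
      have hpi := Real.pi_pos.ne'
      have : (n : ℝ) * M i j * (2 * Real.pi) = k * (2 * Real.pi) := by
        rw [← hmθ]; rw [← hmθ] at hn; linear_combination (M i j : ℝ) * hn
      exact mul_right_cancel₀ (by positivity) this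
    have h' : n * (M i j : ℤ) = k := by exact_mod_cast this
    exact Int.natCast_dvd_natCast.mp ⟨n, by rw [← h', mul_comm]⟩

theorem simple_injective' : Function.Injective cs.simple := by
  intro i j h
  by_contra hij
  have := cs.dvd_of_simple_mul_simple_pow_eq_one (i := i) (j := j) (k := 1) (by rw [h]; simp)
  exact M.off_diagonal i j hij (Nat.dvd_one.mp this)

end Geometric

end CoxeterSystem

section AltList

variable {B : Type*}

/-- The alternating word `s, t, s, …` of length `k`, starting with `s`. -/
def altList (s t : B) : ℕ → List B
  | 0 => []
  | k + 1 => s :: altList t s k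

@[simp] theorem altList_zero (s t : B) : altList s t 0 = [] := rfl

theorem altList_succ (s t : B) (k : ℕ) : altList s t (k + 1) = s :: altList t s k := rfl

@[simp] theorem length_altList (s t : B) (k : ℕ) : (altList s t k).length = k := by
  induction k generalizing s t with
  | zero => rfl
  | succ k ih => simp [altList_succ, ih]

theorem mem_of_mem_altList {s t i : B} {k : ℕ} (h : i ∈ altList s t k) : i = s ∨ i = t := by
  induction k generalizing s t with
  | zero => simp at h
  | succ k ih =>
    rcases List.mem_cons.mp h with h | h
    · exact Or.inl h
    · exact (ih h).symm

theorem altList_add (s t : B) (a b : ℕ) :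
    altList s t (a + b) = altList s t a ++ if Even a then altList s t b else altList t s b := by
  induction a generalizing s t with
  | zero => simp
  | succ a ih =>
    rw [Nat.succ_add, altList_succ, ih, altList_succ, List.cons_append]
    by_cases h : Even a <;> simp [h, Nat.even_add_one]

theorem altList_concat (s t : B) (a : ℕ) :
    altList s t (a + 1) = altList s t a ++ [if Even a then s else t] := by
  rw [altList_add]
  by_cases h : Even a <;> simp [h, altList_succ]

theorem alternatingWord_eq_reverse_altList (s t : B) (k : ℕ) :
    CoxeterSystem.alternatingWord s t k = (altList t s k).reverse := by
  induction k generalizing s t with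
  | zero => rfl
  | succ k ih => rw [CoxeterSystem.alternatingWord_succ, ih, altList_succ]; simp

theorem reverse_altList (s t : B) (k : ℕ) :
    (altList s t k).reverse = if Even k then altList t s k else altList s t k := by
  induction k generalizing s t with
  | zero => simp
  | succ k ih =>
    rw [altList_concat, List.reverse_append, ih]
    by_cases h : Even k <;> simp [h, Nat.even_add_one, ← altList_succ, altList_concat]

theorem alternatingWord_eq_altList (s t : B) (k : ℕ) :
    CoxeterSystem.alternatingWord s t k = if Even k then altList s t k else altList t s k := by
  rw [alternatingWord_eq_reverse_altList, reverse_altList]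

/-- The images of the generators satisfy the braid relations of the Coxeter matrix. -/
def BraidRel (M : CoxeterMatrix B) {N : Type*} [Monoid N] (f : B → N) : Prop :=
  ∀ s t, M s t ≠ 0 → ((altList s t (M s t)).map f).prod = ((altList t s (M s t)).map f).prod

theorem BraidRel.iff_alternatingWord {M : CoxeterMatrix B} {N : Type*} [Monoid N] {f : B → N} :
    BraidRel M f ↔ ∀ s t, M s t ≠ 0 →
      ((CoxeterSystem.alternatingWord s t (M s t)).map f).prod =
        ((CoxeterSystem.alternatingWord t s (M s t)).map f).prod := by
  refine forall₃_congr fun s t h => ?_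
  rw [alternatingWord_eq_altList, alternatingWord_eq_altList]
  by_cases h : Even (M s t) <;> simp [h, eq_comm]

theorem prod_map_altList_two_mul {N : Type*} [Monoid N] (f : B → N) (s t : B) (k : ℕ) :
    ((altList s t (2 * k)).map f).prod = (f s * f t) ^ k := by
  induction k with
  | zero => simp
  | succ k ih =>
    rw [Nat.mul_succ, altList_succ, altList_succ, pow_succ']
    simp [ih, mul_assoc]

end AltList

namespace CoxeterSystem

variable {B W : Type*} [Group W] {M : CoxeterMatrix B} (cs : CoxeterSystem M W)

section ReflectionCocycle

open scoped Classical in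
/-- The action of a simple reflection on pairs of a group element and a scalar, which conjugates
the element and counts how often it is hit by the simple reflection. -/
noncomputable def reflPerm (R : Type*) [Ring R] (i : B) : Equiv.Perm (W × R) where
  toFun x := (cs.simple i * x.1 * cs.simple i, x.2 + if x.1 = cs.simple i then 1 else 0)
  invFun x := (cs.simple i * x.1 * cs.simple i, x.2 - if x.1 = cs.simple i then 1 else 0)
  left_inv x := by
    have : cs.simple i * x.1 * cs.simple i = cs.simple i ↔ x.1 = cs.simple i := by
      rw [mul_eq_right, mul_eq_one_iff_eq_inv', cs.inv_simple]
    ext <;> simp only [this] <;> simp [mul_assoc]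
  right_inv x := by
    have : cs.simple i * x.1 * cs.simple i = cs.simple i ↔ x.1 = cs.simple i := by
      rw [mul_eq_right, mul_eq_one_iff_eq_inv', cs.inv_simple]
    ext <;> simp only [this] <;> simp [mul_assoc]

open scoped Classical in
theorem reflPerm_apply (R : Type*) [Ring R] (i : B) (r : W) (a : R) :
    cs.reflPerm R i (r, a) =
      (cs.simple i * r * cs.simple i, a + if r = cs.simple i then 1 else 0) := rfl

open scoped Classical in
theorem prod_map_reflPerm_apply (R : Type*) [Ring R] (ω : List B) (r : W) (a : R) :
    (ω.map (cs.reflPerm R)).prod (r, a) =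
      (cs.wordProd ω * r * (cs.wordProd ω)⁻¹, a + ((cs.rightInvSeq ω).count r : ℕ)) := by
  induction ω with
  | nil => simp
  | cons i ω ih =>
    have : cs.wordProd ω * r * (cs.wordProd ω)⁻¹ = cs.simple i ↔
        (cs.wordProd ω)⁻¹ * cs.simple i * cs.wordProd ω = r := by
      rw [mul_inv_eq_iff_eq_mul, mul_assoc, inv_mul_eq_iff_eq_mul, eq_comm]
    rw [List.map_cons, List.prod_cons, Equiv.Perm.mul_apply, ih, reflPerm_apply, wordProd_cons,
      rightInvSeq, List.count_cons]
    simp only [this, beq_iff_eq]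
    simp [mul_assoc, add_assoc]

theorem rightInvSeq_alternatingWord_perm (s t : B) (k : ℕ) :
    (cs.rightInvSeq (alternatingWord s t k)).Perm
      ((List.range k).map fun j => cs.simple t * (cs.simple s * cs.simple t) ^ j) := by
  induction k generalizing s t with
  | zero => simp [alternatingWord]
  | succ k ih =>
    rw [alternatingWord_succ, rightInvSeq_concat, List.range_succ_eq_map, List.concat_eq_append]
    refine (List.perm_append_singleton _ _).trans ?_
    rw [List.map_cons, pow_zero, mul_one]
    refine List.Perm.cons _ (((ih t s).map _).trans ?_)
    rw [List.map_map, List.map_map]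
    refine List.Perm.of_eq (List.map_congr_left fun j _ => ?_)
    have : (cs.simple t * cs.simple s) ^ j * cs.simple t =
        cs.simple t * (cs.simple s * cs.simple t) ^ j := by
      have h : SemiconjBy (cs.simple t) (cs.simple s * cs.simple t)
        (cs.simple t * cs.simple s) := by simp [SemiconjBy, mul_assoc]
      exact (h.pow_right j).eq.symm
    simp only [Function.comp_apply, MulAut.conj_apply, inv_simple, Nat.succ_eq_add_one, pow_succ',
      mul_assoc, this]

theorem simple_pow_swap {s t : B} {a b : ℕ} (h : a + b + 1 = M s t) :
    cs.simple s * (cs.simple t * cs.simple s) ^ a =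
      cs.simple t * (cs.simple s * cs.simple t) ^ b := by
  have h1 : (cs.simple t * cs.simple s) ^ (a + 1) * (cs.simple t * cs.simple s) ^ b = 1 := by
    rw [← pow_add, show a + 1 + b = M s t by omega, cs.simple_mul_simple_pow']
  have h2 : (cs.simple t * cs.simple s) ^ (a + 1) = (cs.simple s * cs.simple t) ^ b := by
    rw [eq_inv_of_mul_eq_one_left h1, ← inv_pow, mul_inv_rev, inv_simple, inv_simple]
  rw [← h2, pow_succ', mul_assoc (cs.simple t), cs.simple_mul_simple_cancel_left]

theorem rightInvSeq_alternatingWord_swap (s t : B) :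
    (cs.rightInvSeq (alternatingWord s t (M s t))).Perm
      (cs.rightInvSeq (alternatingWord t s (M s t))) := by
  refine (cs.rightInvSeq_alternatingWord_perm s t _).trans
    (((List.reverse_perm _).symm.trans (List.Perm.of_eq ?_)).trans
      (cs.rightInvSeq_alternatingWord_perm t s _).symm)
  have hrev : (List.range (M s t)).reverse = (List.range (M s t)).map (0 + M s t - 1 - ·) := by
    rw [← List.reverse_range', ← List.range_eq_range']
  rw [← List.map_reverse, hrev, List.map_map]
  refine List.map_congr_left fun j hj => ?_
  have hj := List.mem_range.mp hj
  exact (cs.simple_pow_swap (by dsimp only; omega)).symm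

theorem wordProd_alternatingWord_swap (s t : B) :
    cs.wordProd (alternatingWord s t (M s t)) = cs.wordProd (alternatingWord t s (M s t)) := by
  have := cs.wordProd_braidWord_eq s t
  rwa [braidWord, braidWord, M.symmetric t s] at this

theorem braidRel_simple : BraidRel M cs.simple :=
  BraidRel.iff_alternatingWord.mpr fun s t _ => cs.wordProd_alternatingWord_swap s t

theorem braidRel_reflPerm (R : Type*) [Ring R] : BraidRel M (cs.reflPerm R) :=
  BraidRel.iff_alternatingWord.mpr fun s t _ => by
    classical
    ext1 ⟨r, a⟩
    rw [prod_map_reflPerm_apply, prod_map_reflPerm_apply, wordProd_alternatingWord_swap,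
      (cs.rightInvSeq_alternatingWord_swap s t).count_eq]

theorem reflPerm_isLiftable : M.IsLiftable (cs.reflPerm (ZMod 2)) := by
  classical
  intro s t
  have h0 : alternatingWord s t (2 * M s t) = altList s t (2 * M s t) := by
    rw [alternatingWord_eq_altList]; simp
  have h1 : cs.wordProd (altList s t (2 * M s t)) = 1 := by
    rw [wordProd, prod_map_altList_two_mul, simple_mul_simple_pow]
  rw [← prod_map_altList_two_mul]
  ext1 ⟨r, a⟩
  rw [prod_map_reflPerm_apply, h1, ← h0, (cs.rightInvSeq_alternatingWord_perm s t _).count_eq,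
    two_mul, List.range_add, List.map_append, List.map_map, List.count_append]
  have : ((fun j => cs.simple t * (cs.simple s * cs.simple t) ^ j) ∘ fun x => M s t + x) =
      fun j => cs.simple t * (cs.simple s * cs.simple t) ^ j := by
    funext j; simp [pow_add]
  rw [this]
  simp [← two_mul, show (2 : ZMod 2) = 0 from rfl]

/-- The parity with which a group element occurs in the left inversion sequence. -/
noncomputable def invParity (w t : W) : ZMod 2 :=
  (cs.lift ⟨_, cs.reflPerm_isLiftable⟩ w⁻¹ (t, 0)).2

open scoped Classical in
theorem invParity_wordProd (ω : List B) (t : W) :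
    cs.invParity (cs.wordProd ω) t = (cs.leftInvSeq ω).count t := by
  have : ∀ η : List B, cs.lift ⟨_, cs.reflPerm_isLiftable⟩ (cs.wordProd η) =
      (η.map (cs.reflPerm (ZMod 2))).prod := fun η => by
    rw [wordProd, map_list_prod, List.map_map]
    congr 2
    funext i
    exact cs.lift_apply_simple _ i
  rw [invParity, ← wordProd_reverse, this, prod_map_reflPerm_apply, rightInvSeq_reverse,
    List.count_reverse, zero_add]

/-- The exchange property. -/
theorem exchange {ω : List B} {i : B} (h : cs.IsLeftDescent (cs.wordProd ω) i) :
    ∃ j < ω.length, cs.simple i * cs.wordProd ω = cs.wordProd (ω.eraseIdx j) := by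
  classical
  obtain ⟨η, hη, he⟩ := cs.exists_isReduced (cs.simple i * cs.wordProd ω)
  have hmem : cs.simple i ∉ cs.leftInvSeq η := fun hm => by
    have := (cs.isLeftInversion_of_mem_leftInvSeq hη hm).2
    rw [← he, cs.simple_mul_simple_cancel_left] at this
    exact absurd h (not_lt_of_gt this)
  have h1 : cs.invParity (cs.wordProd ω) (cs.simple i) = 1 := by
    have hw : cs.wordProd ω = cs.wordProd (i :: η) := by
      rw [wordProd_cons, ← he, cs.simple_mul_simple_cancel_left]
    rw [hw, invParity_wordProd, leftInvSeq, List.count_cons_self, List.count_eq_zero.mpr]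
    · simp
    · intro hm
      obtain ⟨r, hr, hr'⟩ := List.mem_map.mp hm
      have : r = cs.simple i := by
        rw [MulAut.conj_apply, mul_inv_eq_iff_eq_mul] at hr'
        exact mul_left_cancel hr'
      exact hmem (this ▸ hr)
  rw [invParity_wordProd] at h1
  have hpos : cs.simple i ∈ cs.leftInvSeq ω := by
    rw [← List.count_pos_iff]
    by_contra h0
    rw [Nat.eq_zero_of_not_pos h0] at h1
    exact absurd h1 (by decide)
  obtain ⟨j, hj, hj'⟩ := List.mem_iff_getElem.mp hpos
  refine ⟨j, by simpa using hj, ?_⟩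
  rw [← cs.getD_leftInvSeq_mul_wordProd, List.getD_eq_getElem _ _ hj, hj']

end ReflectionCocycle

end CoxeterSystem

namespace CoxeterSystem

variable {B W : Type*} [Group W] {M : CoxeterMatrix B} (cs : CoxeterSystem M W)

theorem length_simple_mul_of_not_isLeftDescent {w : W} {i : B} (h : ¬ cs.IsLeftDescent w i) :
    cs.length (cs.simple i * w) = cs.length w + 1 := cs.not_isLeftDescent_iff.mp h

theorem isReduced_cons_iff {ω : List B} (h : cs.IsReduced ω) {i : B} :
    cs.IsReduced (i :: ω) ↔ ¬ cs.IsLeftDescent (cs.wordProd ω) i := by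
  rw [cs.not_isLeftDescent_iff, IsReduced, wordProd_cons, h.eq, List.length_cons]

theorem IsReduced.tail {cs : CoxeterSystem M W} {i : B} {ω : List B} (h : cs.IsReduced (i :: ω)) :
    cs.IsReduced ω := h.drop 1

theorem IsReduced.isLeftDescent {cs : CoxeterSystem M W} {i : B} {ω : List B}
    (h : cs.IsReduced (i :: ω)) : cs.IsLeftDescent (cs.wordProd (i :: ω)) i := by
  rw [IsLeftDescent, wordProd_cons, cs.simple_mul_simple_cancel_left, ← wordProd_cons, h.eq,
    h.tail.eq]
  simp

theorem isReduced_append {ω η : List B} (hω : cs.IsReduced ω) (hη : cs.IsReduced η)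
    (h : cs.length (cs.wordProd ω * cs.wordProd η) =
      cs.length (cs.wordProd ω) + cs.length (cs.wordProd η)) : cs.IsReduced (ω ++ η) := by
  rw [IsReduced, wordProd_append, h, hω.eq, hη.eq, List.length_append]

/-- If an element has a left descent, it has a reduced word starting with it. -/
theorem IsLeftDescent.exists_isReduced {cs : CoxeterSystem M W} {w : W} {i : B}
    (h : cs.IsLeftDescent w i) :
    ∃ ω, cs.IsReduced (i :: ω) ∧ w = cs.wordProd (i :: ω) := by
  obtain ⟨ω, hω, he⟩ := cs.exists_isReduced (cs.simple i * w)
  have hw : w = cs.wordProd (i :: ω) := by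
    rw [wordProd_cons, ← he, cs.simple_mul_simple_cancel_left]
  refine ⟨ω, ?_, hw⟩
  rw [IsReduced, ← hw, List.length_cons, ← hω.eq, ← he]
  exact (cs.isLeftDescent_iff.mp h).symm

section Parabolic

/-- The standard parabolic subgroup generated by a set of simple reflections. -/
def parabolic (K : Set B) : Subgroup W := Subgroup.closure (cs.simple '' K)

theorem simple_mem_parabolic {K : Set B} {i : B} (h : i ∈ K) : cs.simple i ∈ cs.parabolic K :=
  Subgroup.subset_closure ⟨i, h, rfl⟩

theorem parabolic_mono {K L : Set B} (h : K ⊆ L) : cs.parabolic K ≤ cs.parabolic L :=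
  Subgroup.closure_mono (Set.image_mono h)

theorem wordProd_mem_parabolic {K : Set B} {ω : List B} (h : ∀ i ∈ ω, i ∈ K) :
    cs.wordProd ω ∈ cs.parabolic K := by
  rw [wordProd]
  refine Subgroup.list_prod_mem _ fun x hx => ?_
  obtain ⟨i, hi, rfl⟩ := List.mem_map.mp hx
  exact cs.simple_mem_parabolic (h i hi)

theorem exists_isReduced_of_word {K : Set B} {ω : List B} (h : ∀ i ∈ ω, i ∈ K) :
    ∃ η, cs.IsReduced η ∧ (∀ i ∈ η, i ∈ K) ∧ cs.wordProd ω = cs.wordProd η := by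
  induction ω with
  | nil => exact ⟨[], by simp [IsReduced], h, rfl⟩
  | cons i ω ih =>
    obtain ⟨η, hη, hK, he⟩ := ih fun j hj => h j (List.mem_cons_of_mem _ hj)
    have hi := h i List.mem_cons_self
    by_cases hd : cs.IsLeftDescent (cs.wordProd η) i
    · obtain ⟨j, hj, hj'⟩ := cs.exchange hd
      refine ⟨η.eraseIdx j, ?_, fun k hk => hK k (List.mem_of_mem_eraseIdx hk), ?_⟩
      · have := cs.isLeftDescent_iff.mp hd
        rw [hj', hη.eq] at this
        rw [IsReduced, List.length_eraseIdx_of_lt hj]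
        omega
      · rw [wordProd_cons, he, hj']
    · exact ⟨i :: η, (cs.isReduced_cons_iff hη).mpr hd, by simpa using ⟨hi, hK⟩,
        by rw [wordProd_cons, wordProd_cons, he]⟩

theorem exists_isReduced_of_mem_parabolic {K : Set B} {w : W} (h : w ∈ cs.parabolic K) :
    ∃ η, cs.IsReduced η ∧ (∀ i ∈ η, i ∈ K) ∧ w = cs.wordProd η := by
  suffices ∃ ω, (∀ i ∈ ω, i ∈ K) ∧ w = cs.wordProd ω by
    obtain ⟨ω, hω, rfl⟩ := this
    exact cs.exists_isReduced_of_word hω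
  induction h using Subgroup.closure_induction with
  | mem x hx =>
    obtain ⟨i, hi, rfl⟩ := hx
    exact ⟨[i], by simpa using hi, by simp⟩
  | one => exact ⟨[], by simp, by simp⟩
  | mul x y _ _ hx hy =>
    obtain ⟨ω, hω, rfl⟩ := hx
    obtain ⟨η, hη, rfl⟩ := hy
    exact ⟨ω ++ η, fun i hi => (List.mem_append.mp hi).elim (hω i) (hη i),
      (cs.wordProd_append _ _).symm⟩
  | inv x _ hx =>
    obtain ⟨ω, hω, rfl⟩ := hx
    exact ⟨ω.reverse, fun i hi => hω i (List.mem_reverse.mp hi), by simp⟩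

theorem simple_mem_parabolic_iff {K : Set B} {i : B} :
    cs.simple i ∈ cs.parabolic K ↔ i ∈ K := by
  refine ⟨fun h => ?_, cs.simple_mem_parabolic⟩
  obtain ⟨η, hη, hK, he⟩ := cs.exists_isReduced_of_mem_parabolic h
  have h1 : η.length = 1 := by rw [← hη.eq, ← he, cs.length_simple]
  obtain ⟨j, rfl⟩ := List.length_eq_one_iff.mp h1
  rw [wordProd_singleton] at he
  rw [cs.simple_injective' he]
  exact hK j (by simp)

theorem mem_of_isReduced_of_mem_parabolic {K : Set B} {ω : List B} (hω : cs.IsReduced ω)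
    (h : cs.wordProd ω ∈ cs.parabolic K) : ∀ i ∈ ω, i ∈ K := by
  induction ω with
  | nil => simp
  | cons i ω ih =>
    obtain ⟨η, hη, hK, he⟩ := cs.exists_isReduced_of_mem_parabolic h
    have hd := hω.isLeftDescent
    rw [he] at hd
    obtain ⟨j, -, hj⟩ := cs.exchange hd
    have h1 : cs.simple i * cs.wordProd η ∈ cs.parabolic K := by
      rw [hj]
      exact cs.wordProd_mem_parabolic fun k hk => hK k (List.mem_of_mem_eraseIdx hk)
    rw [← he] at h1
    have h2 : cs.simple i ∈ cs.parabolic K := (Subgroup.mul_mem_cancel_right _ h).mp h1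
    rw [wordProd_cons, cs.simple_mul_simple_cancel_left] at h1
    exact List.forall_mem_cons.mpr ⟨cs.simple_mem_parabolic_iff.mp h2, ih hω.tail h1⟩

/-- An element without left descents in `K`. -/
def IsLeftMin (K : Set B) (v : W) : Prop := ∀ i ∈ K, ¬ cs.IsLeftDescent v i

theorem exists_parabolic_mul (K : Set B) (w : W) :
    ∃ u ∈ cs.parabolic K, ∃ v, w = u * v ∧
      ∀ x ∈ cs.parabolic K, cs.length (x * v) = cs.length x + cs.length v := by
  classical
  have hex : ∃ n, ∃ x ∈ cs.parabolic K, cs.length (x * w) = n :=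
    ⟨_, 1, Subgroup.one_mem _, rfl⟩
  obtain ⟨x, hx, hxn⟩ := Nat.find_spec hex
  have hmin : ∀ y ∈ cs.parabolic K, cs.length (x * w) ≤ cs.length (y * (x * w)) := by
    intro y hy
    rw [hxn]
    exact Nat.find_min' hex ⟨y * x, Subgroup.mul_mem _ hy hx, by rw [mul_assoc]⟩
  refine ⟨x⁻¹, Subgroup.inv_mem _ hx, x * w, by simp, ?_⟩
  generalize x * w = v at hmin
  intro y hy
  obtain ⟨η, hη, hK, rfl⟩ := cs.exists_isReduced_of_mem_parabolic hy
  clear hy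
  induction η with
  | nil => simp
  | cons i η ih =>
    have hi : i ∈ K := hK i (by simp)
    have hK' : ∀ j ∈ η, j ∈ K := fun j hj => hK j (List.mem_cons_of_mem _ hj)
    have ih := ih hη.tail hK'
    obtain ⟨ω, hω, rfl⟩ := cs.exists_isReduced v
    suffices hd : ¬ cs.IsLeftDescent (cs.wordProd η * cs.wordProd ω) i by
      rw [wordProd_cons, mul_assoc, cs.length_simple_mul_of_not_isLeftDescent hd, ih,
        ← wordProd_cons, hη.eq, hη.tail.eq, List.length_cons]
      omega
    intro hd
    rw [← wordProd_append] at hd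
    obtain ⟨j, hj, he⟩ := cs.exchange hd
    rcases lt_or_ge j η.length with hlt | hge
    · rw [List.eraseIdx_append_of_lt_length hlt, wordProd_append, wordProd_append,
        ← mul_assoc] at he
      have he' := mul_right_cancel he
      have h1 := cs.length_wordProd_le (η.eraseIdx j)
      rw [← he', ← wordProd_cons, hη.eq, List.length_eraseIdx_of_lt hlt, List.length_cons] at h1
      omega
    · rw [List.eraseIdx_append_of_length_le hge, wordProd_append, wordProd_append] at he
      have h1 := hmin ((cs.wordProd η)⁻¹ * (cs.simple i * cs.wordProd η))
        (Subgroup.mul_mem _ (Subgroup.inv_mem _ (cs.wordProd_mem_parabolic hK'))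
          (Subgroup.mul_mem _ (cs.simple_mem_parabolic hi) (cs.wordProd_mem_parabolic hK')))
      rw [mul_assoc, mul_assoc, he, inv_mul_cancel_left, hω.eq] at h1
      have h2 := cs.length_wordProd_le (ω.eraseIdx (j - η.length))
      rw [List.length_append] at hj
      rw [List.length_eraseIdx_of_lt (by omega)] at h2
      omega

theorem exists_isLeftDescent_of_mem_parabolic {K : Set B} {u : W} (hu : u ∈ cs.parabolic K)
    (h1 : u ≠ 1) : ∃ i ∈ K, cs.IsLeftDescent u i := by
  obtain ⟨η, hη, hK, rfl⟩ := cs.exists_isReduced_of_mem_parabolic hu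
  cases η with
  | nil => simp at h1
  | cons i η => exact ⟨i, hK i (by simp), hη.isLeftDescent⟩

variable {cs}

theorem isLeftDescent_mul_of_length {u v : W} {i : B}
    (h : cs.length (u * v) = cs.length u + cs.length v) (hd : cs.IsLeftDescent u i) :
    cs.IsLeftDescent (u * v) i := by
  rw [IsLeftDescent] at hd ⊢
  have := cs.length_mul_le (cs.simple i * u) v
  rw [mul_assoc] at this
  omega

theorem IsLeftMin.length_mul {K : Set B} {u v : W} (hv : cs.IsLeftMin K v)
    (hu : u ∈ cs.parabolic K) : cs.length (u * v) = cs.length u + cs.length v := by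
  obtain ⟨x, hx, y, rfl, hy⟩ := cs.exists_parabolic_mul K v
  have : x = 1 := by
    by_contra hne
    obtain ⟨i, hi, hd⟩ := cs.exists_isLeftDescent_of_mem_parabolic hx hne
    exact hv i hi (isLeftDescent_mul_of_length (hy x hx) hd)
  subst this
  rw [one_mul]
  exact hy u hu

theorem isLeftMin_of_length_mul {K : Set B} {v : W}
    (h : ∀ x ∈ cs.parabolic K, cs.length (x * v) = cs.length x + cs.length v) :
    cs.IsLeftMin K v := fun i hi => by
  rw [cs.not_isLeftDescent_iff, h _ (cs.simple_mem_parabolic hi), cs.length_simple, add_comm]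

theorem IsLeftMin.isLeftDescent_mul_iff {K : Set B} {u v : W} (hv : cs.IsLeftMin K v)
    (hu : u ∈ cs.parabolic K) {i : B} (hi : i ∈ K) :
    cs.IsLeftDescent (u * v) i ↔ cs.IsLeftDescent u i := by
  rw [IsLeftDescent, IsLeftDescent, hv.length_mul hu, ← mul_assoc,
    hv.length_mul (Subgroup.mul_mem _ (cs.simple_mem_parabolic hi) hu)]
  omega

theorem exists_parabolic_mul_isLeftMin (cs : CoxeterSystem M W) (K : Set B) (w : W) :
    ∃ u ∈ cs.parabolic K, ∃ v, cs.IsLeftMin K v ∧ w = u * v := by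
  obtain ⟨u, hu, v, h, hv⟩ := cs.exists_parabolic_mul K w
  exact ⟨u, hu, v, isLeftMin_of_length_mul hv, h⟩

end Parabolic

section Dihedral

theorem eq_altList_of_isReduced {s t : B} {ω : List B} (hω : cs.IsReduced (s :: ω))
    (h : ∀ i ∈ ω, i = s ∨ i = t) : s :: ω = altList s t (ω.length + 1) := by
  induction ω generalizing s t with
  | nil => rfl
  | cons j ω ih =>
    have hj : j = t := by
      rcases h j (by simp) with rfl | h
      · have h1 := cs.length_wordProd_le ω
        have h2 := hω.eq
        rw [wordProd_cons, wordProd_cons, cs.simple_mul_simple_cancel_left] at h2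
        simp at h2
        omega
      · exact h
    subst hj
    rw [ih hω.tail fun i hi => (h i (List.mem_cons_of_mem _ hi)).symm, length_altList]
    rfl

theorem simple_mul_pow_of_wordProd_altList_eq {s t : B} {k : ℕ}
    (h : cs.wordProd (altList s t k) = cs.wordProd (altList t s k)) :
    (cs.simple s * cs.simple t) ^ k = 1 := by
  have h1 : cs.wordProd (altList s t (2 * k)) =
      cs.wordProd (altList s t k) * cs.wordProd (altList t s k).reverse := by
    rw [two_mul, altList_add, wordProd_append, reverse_altList]
  rw [wordProd_reverse, h, mul_inv_cancel, wordProd, prod_map_altList_two_mul] at h1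
  exact h1

/-- The join of two simple reflections in the weak order. -/
def braidLcm (s t : B) : W := cs.wordProd (altList s t (M s t))

theorem braidLcm_comm (s t : B) : cs.braidLcm s t = cs.braidLcm t s := by
  rw [braidLcm, braidLcm, M.symmetric t s]
  by_cases h : M s t = 0
  · simp [h]
  · exact cs.braidRel_simple s t h

theorem braidLcm_self (s : B) : cs.braidLcm s s = cs.simple s := by
  rw [braidLcm, M.diagonal]; simp [altList_succ]

variable {cs}

/-- Two left descents force the braid word to be a prefix. -/
theorem IsLeftDescent.exists_braidLcm_mul {w : W} {s t : B}
    (hs : cs.IsLeftDescent w s) (ht : cs.IsLeftDescent w t) :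
    M s t ≠ 0 ∧ cs.IsReduced (altList s t (M s t)) ∧
      ∃ v, cs.IsLeftMin {s, t} v ∧ w = cs.braidLcm s t * v := by
  obtain ⟨u, hu, v, hv, rfl⟩ := cs.exists_parabolic_mul_isLeftMin {s, t} w
  rw [hv.isLeftDescent_mul_iff hu (by simp)] at hs ht
  obtain ⟨ω, hω, he⟩ := hs.exists_isReduced
  obtain ⟨η, hη, hf⟩ := ht.exists_isReduced
  have h1 := cs.mem_of_isReduced_of_mem_parabolic hω (he ▸ hu)
  have h2 := cs.mem_of_isReduced_of_mem_parabolic hη (hf ▸ hu)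
  have h1' := cs.eq_altList_of_isReduced (t := t) hω
    fun i hi => by simpa using h1 i (List.mem_cons_of_mem _ hi)
  have h2' := cs.eq_altList_of_isReduced (t := s) hη
    fun i hi => by simpa [or_comm] using h2 i (List.mem_cons_of_mem _ hi)
  have hlen : η.length = ω.length := by
    have := hω.eq
    rw [← he, hf, hη.eq] at this
    simpa using this
  rw [hlen] at h2'
  have hpow := cs.simple_mul_pow_of_wordProd_altList_eq (s := s) (t := t) (k := ω.length + 1)
    (by rw [← h1', ← h2', ← he, ← hf])
  have hdvd := cs.dvd_of_simple_mul_simple_pow_eq_one hpow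
  have h0 : M s t ≠ 0 := fun h => by
    rw [h] at hdvd
    exact absurd (Nat.eq_zero_of_zero_dvd hdvd) (by simp)
  have hle : ω.length + 1 ≤ M s t := by
    by_contra hlt
    rw [not_le] at hlt
    have hr : cs.IsReduced (alternatingWord t s (ω.length + 1)) := by
      rw [alternatingWord_eq_reverse_altList, isReduced_reverse_iff, ← h1']
      exact hω
    exact cs.not_isReduced_alternatingWord t s (by rwa [M.symmetric]) (by rwa [M.symmetric]) hr
  have hk : ω.length + 1 = M s t := le_antisymm hle (Nat.le_of_dvd (by omega) hdvd)
  rw [hk] at h1'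
  refine ⟨h0, h1' ▸ hω, v, hv, ?_⟩
  rw [braidLcm, ← h1', ← he]

end Dihedral

end CoxeterSystem

namespace CoxeterSystem

variable {B W : Type*} [Group W] {M : CoxeterMatrix B} (cs : CoxeterSystem M W)

theorem coxeterMatrix_ne_zero (cs : CoxeterSystem M W) [Finite W] (s t : B) :
    M s t ≠ 0 := fun h => by
  have := cs.dvd_of_simple_mul_simple_pow_eq_one (pow_orderOf_eq_one (cs.simple s * cs.simple t))
  rw [h, zero_dvd_iff] at this
  exact (orderOf_pos (cs.simple s * cs.simple t)).ne' this

theorem isReduced_altList {s t : B} (h0 : M s t ≠ 0) {k : ℕ} (hk : k ≤ M s t) :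
    cs.IsReduced (altList s t k) := by
  induction k generalizing s t with
  | zero => simp [IsReduced]
  | succ k ih =>
    have ih := ih (s := t) (t := s) (by rwa [M.symmetric]) (by rw [M.symmetric]; omega)
    rw [altList_succ, cs.isReduced_cons_iff ih]
    intro hd
    cases k with
    | zero => exact cs.not_isLeftDescent_one s (by simpa using hd)
    | succ k =>
      obtain ⟨-, hr, v, hv, he⟩ := ih.isLeftDescent.exists_braidLcm_mul hd
      have h1 := hv.length_mul (u := cs.braidLcm t s) (by
        rw [braidLcm]
        exact cs.wordProd_mem_parabolic fun i hi => by
          simpa using mem_of_mem_altList hi)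
      rw [← he, ← altList_succ, ih.eq, braidLcm, hr.eq, length_altList, length_altList,
        M.symmetric] at h1
      omega

theorem length_braidLcm {s t : B} (h0 : M s t ≠ 0) : cs.length (cs.braidLcm s t) = M s t := by
  rw [braidLcm, (cs.isReduced_altList h0 le_rfl).eq, length_altList]

theorem braidLcm_mem_parabolic (s t : B) : cs.braidLcm s t ∈ cs.parabolic {s, t} :=
  cs.wordProd_mem_parabolic fun i hi => by simpa using mem_of_mem_altList hi

section Matsumoto

variable {N : Type*} [Monoid N] {f : B → N}

/-- Matsumoto's theorem. -/
theorem prod_map_eq_of_isReduced (hf : BraidRel M f) {ω η : List B} (hω : cs.IsReduced ω)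
    (hη : cs.IsReduced η) (h : cs.wordProd ω = cs.wordProd η) :
    (ω.map f).prod = (η.map f).prod := by
  have hlen : ω.length = η.length := by rw [← hω.eq, h, hη.eq]
  generalize hn : ω.length = n
  induction n generalizing ω η with
  | zero =>
    rw [List.length_eq_zero_iff] at hn
    subst hn
    rw [List.length_nil, eq_comm, List.length_eq_zero_iff] at hlen
    rw [hlen]
  | succ n ih =>
    match ω, η, hlen, hn with
    | s :: ω, t :: η, hlen, hn =>
      have hs := hω.isLeftDescent
      have ht := hη.isLeftDescent
      rw [← h] at ht
      simp only [List.length_cons, Nat.add_right_cancel_iff] at hlen hn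
      obtain ⟨h0, -, v, hv, he⟩ := hs.exists_braidLcm_mul ht
      obtain ⟨θ, hθ, rfl⟩ := cs.exists_isReduced v
      have key : ∀ a b : B, M a b = M s t → cs.braidLcm s t = cs.braidLcm a b →
          ∀ {ξ}, cs.IsReduced (a :: ξ) → cs.wordProd (a :: ξ) = cs.wordProd (s :: ω) →
          ξ.length = n → ((a :: ξ).map f).prod = ((altList a b (M s t) ++ θ).map f).prod := by
        intro a b hab hl ξ hξ hξ' hξn
        obtain ⟨m, hm⟩ : ∃ m, M s t = m + 1 := Nat.exists_eq_succ_of_ne_zero h0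
        have hr : cs.IsReduced (a :: (altList b a m ++ θ)) := by
          rw [← List.cons_append, ← altList_succ, ← hm, ← hab]
          refine cs.isReduced_append (cs.isReduced_altList (by rwa [hab]) le_rfl) hθ ?_
          change cs.length (cs.braidLcm a b * _) = cs.length (cs.braidLcm a b) + _
          rw [← hl]
          exact hv.length_mul (cs.braidLcm_mem_parabolic s t)
        have hp : cs.wordProd (a :: (altList b a m ++ θ)) = cs.wordProd (a :: ξ) := by
          rw [hξ', he, hl, ← List.cons_append, ← altList_succ, ← hm, ← hab, wordProd_append,
            braidLcm]
        rw [hm, altList_succ, List.cons_append, List.map_cons, List.map_cons, List.prod_cons,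
          List.prod_cons]
        congr 1
        refine ih hξ.tail hr.tail ?_ ?_ hξn
        · rw [wordProd_cons, wordProd_cons] at hp
          exact (mul_left_cancel hp).symm
        · have := hr.eq
          rw [hp, hξ.eq] at this
          simpa using this
      rw [key s t rfl rfl hω rfl hn,
        key t s (M.symmetric _ _) (cs.braidLcm_comm _ _) hη h.symm (by omega),
        List.map_append, List.map_append, List.prod_append, List.prod_append, hf s t h0]

/-- The extension of a braid-compatible map to the Coxeter group along reduced words. -/
noncomputable def braidLift (f : B → N) (w : W) : N :=
  ((cs.exists_isReduced w).choose.map f).prod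

theorem braidLift_wordProd (hf : BraidRel M f) {ω : List B} (hω : cs.IsReduced ω) :
    cs.braidLift f (cs.wordProd ω) = (ω.map f).prod :=
  have h := (cs.exists_isReduced (cs.wordProd ω)).choose_spec
  cs.prod_map_eq_of_isReduced hf h.1 hω h.2.symm

theorem braidLift_one (hf : BraidRel M f) : cs.braidLift f 1 = 1 := by
  simpa using cs.braidLift_wordProd hf (ω := []) (by simp [IsReduced])

theorem braidLift_simple (hf : BraidRel M f) (i : B) : cs.braidLift f (cs.simple i) = f i := by
  simpa using cs.braidLift_wordProd hf (ω := [i]) (by simp [IsReduced])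

theorem braidLift_mul (hf : BraidRel M f) {x y : W}
    (h : cs.length (x * y) = cs.length x + cs.length y) :
    cs.braidLift f (x * y) = cs.braidLift f x * cs.braidLift f y := by
  obtain ⟨ω, hω, rfl⟩ := cs.exists_isReduced x
  obtain ⟨η, hη, rfl⟩ := cs.exists_isReduced y
  rw [← wordProd_append, cs.braidLift_wordProd hf (cs.isReduced_append hω hη h),
    cs.braidLift_wordProd hf hω, cs.braidLift_wordProd hf hη, List.map_append, List.prod_append]

end Matsumoto

section WeakOrder

/-- The right weak order: `x` is a prefix of `y`. -/
def PrefixLE (x y : W) : Prop := cs.length y = cs.length x + cs.length (x⁻¹ * y)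

variable {cs}

theorem prefixLE_mul_iff {x y : W} :
    cs.PrefixLE x (x * y) ↔ cs.length (x * y) = cs.length x + cs.length y := by
  rw [PrefixLE, inv_mul_cancel_left]

theorem PrefixLE.refl (x : W) : cs.PrefixLE x x := by simp [PrefixLE]

theorem PrefixLE.length_le {x y : W} (h : cs.PrefixLE x y) : cs.length x ≤ cs.length y := by
  rw [PrefixLE] at h; omega

theorem PrefixLE.trans {x y z : W} (h : cs.PrefixLE x y) (h' : cs.PrefixLE y z) :
    cs.PrefixLE x z := by
  rw [PrefixLE] at *
  have h1 := cs.length_mul_le (x⁻¹ * y) (y⁻¹ * z)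
  have h2 := cs.length_mul_le x (x⁻¹ * z)
  rw [mul_assoc, mul_inv_cancel_left] at h1
  rw [mul_inv_cancel_left] at h2
  omega

theorem PrefixLE.antisymm {x y : W} (h : cs.PrefixLE x y) (h' : cs.PrefixLE y x) : x = y := by
  have := h'.length_le
  rw [PrefixLE] at h
  have h0 : cs.length (x⁻¹ * y) = 0 := by omega
  rw [cs.length_eq_zero_iff, inv_mul_eq_one] at h0
  exact h0

theorem PrefixLE.exists_simple {x y : W} (h : cs.PrefixLE x y) (hne : x ≠ y) :
    ∃ i, cs.length (x * cs.simple i) = cs.length x + 1 ∧ cs.PrefixLE (x * cs.simple i) y := by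
  obtain ⟨i, hi⟩ := cs.exists_leftDescent_of_ne_one (w := x⁻¹ * y)
    (by rwa [Ne, inv_mul_eq_one])
  rw [cs.isLeftDescent_iff] at hi
  rw [PrefixLE] at h
  have h1 := cs.length_mul_le (x * cs.simple i) (cs.simple i * (x⁻¹ * y))
  have h2 : x * cs.simple i * (cs.simple i * (x⁻¹ * y)) = y := by
    rw [mul_assoc, cs.simple_mul_simple_cancel_left, mul_inv_cancel_left]
  rw [h2] at h1
  have h3 := cs.length_mul_le x (cs.simple i)
  rw [cs.length_simple] at h3
  refine ⟨i, by omega, ?_⟩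
  rw [PrefixLE, mul_inv_rev, cs.inv_simple, mul_assoc]
  omega

theorem length_mul_of_isLeftMin_inv {K : Set B} {z u : W} (hz : cs.IsLeftMin K z⁻¹)
    (hu : u ∈ cs.parabolic K) : cs.length (z * u) = cs.length z + cs.length u := by
  rw [← cs.length_inv (z * u), mul_inv_rev, hz.length_mul (Subgroup.inv_mem _ hu), cs.length_inv,
    cs.length_inv, add_comm]

theorem isLeftMin_inv_pair {z : W} {s t : B} (hs : cs.length (z * cs.simple s) = cs.length z + 1)
    (ht : cs.length (z * cs.simple t) = cs.length z + 1) : cs.IsLeftMin {s, t} z⁻¹ := by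
  rintro i (rfl | rfl) <;> rw [isLeftDescent_inv_iff, cs.not_isRightDescent_iff] <;> assumption

theorem prefixLE_mul_braidLcm {z : W} {s t : B} (h0 : M s t ≠ 0)
    (hs : cs.length (z * cs.simple s) = cs.length z + 1)
    (ht : cs.length (z * cs.simple t) = cs.length z + 1) :
    cs.PrefixLE (z * cs.simple s) (z * cs.braidLcm s t) := by
  have hz := isLeftMin_inv_pair hs ht
  have h2 := length_mul_of_isLeftMin_inv hz (cs.braidLcm_mem_parabolic s t)
  have hr := cs.isReduced_altList h0 le_rfl
  obtain ⟨m, hm⟩ : ∃ m, M s t = m + 1 := Nat.exists_eq_succ_of_ne_zero h0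
  have h3 : cs.simple s * cs.braidLcm s t = cs.wordProd (altList t s m) := by
    rw [braidLcm, hm, altList_succ, wordProd_cons, cs.simple_mul_simple_cancel_left]
  have h4 : cs.length (cs.wordProd (altList t s m)) = m := by
    rw [hm, altList_succ] at hr
    rw [hr.tail.eq, length_altList]
  rw [PrefixLE, h2, hs, mul_inv_rev, cs.inv_simple, mul_assoc, inv_mul_cancel_left, h3, h4,
    cs.length_braidLcm h0]
  omega

theorem exists_length_le (cs : CoxeterSystem M W) [Finite W] : ∃ b, ∀ w, cs.length w ≤ b := by
  obtain ⟨b, hb⟩ := (Set.finite_range cs.length).bddAbove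
  exact ⟨b, fun w => hb ⟨w, rfl⟩⟩

/-- A down-closed set of group elements, closed under local joins, has a maximum. -/
theorem exists_prefixLE_max (cs : CoxeterSystem M W) [Finite W] {D : Set W} (h1 : 1 ∈ D)
    (hdown : ∀ x y, cs.PrefixLE x y → y ∈ D → x ∈ D)
    (hjoin : ∀ z s t, cs.length (z * cs.simple s) = cs.length z + 1 →
      cs.length (z * cs.simple t) = cs.length z + 1 → z * cs.simple s ∈ D → z * cs.simple t ∈ D →
      z * cs.braidLcm s t ∈ D) : ∃ m ∈ D, ∀ y ∈ D, cs.PrefixLE y m := by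
  obtain ⟨b, hb⟩ := cs.exists_length_le
  suffices ∀ n, ∀ z ∈ D, b ≤ cs.length z + n →
      ∃ m ∈ D, cs.PrefixLE z m ∧ ∀ y ∈ D, cs.PrefixLE z y → cs.PrefixLE y m by
    obtain ⟨m, hm, -, h⟩ := this b 1 h1 (by simp)
    exact ⟨m, hm, fun y hy => h y hy (by simp [PrefixLE])⟩
  intro n
  induction n with
  | zero =>
    intro z hz hle
    refine ⟨z, hz, .refl z, fun y _ h => ?_⟩
    have := hb y
    by_cases hne : z = y
    · exact hne ▸ .refl z
    obtain ⟨i, hi, -⟩ := h.exists_simple hne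
    have := hb (z * cs.simple i)
    omega
  | succ n ih =>
    intro z hz hle
    by_cases hex : ∃ s, cs.length (z * cs.simple s) = cs.length z + 1 ∧ z * cs.simple s ∈ D
    · obtain ⟨s, hs, hsD⟩ := hex
      have hzs : ∀ i, cs.length (z * cs.simple i) = cs.length z + 1 →
          cs.PrefixLE z (z * cs.simple i) := fun i h => by
        rw [prefixLE_mul_iff, h, cs.length_simple]
      obtain ⟨m, hm, hsm, hmax⟩ := ih _ hsD (by omega)
      refine ⟨m, hm, (hzs s hs).trans hsm, fun y hy h => ?_⟩
      by_cases hne : z = y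
      · exact hne ▸ (hzs s hs).trans hsm
      obtain ⟨t, ht, hty⟩ := h.exists_simple hne
      have htD := hdown _ _ hty hy
      obtain ⟨m', hm', htm', hmax'⟩ := ih _ htD (by omega)
      have hj := hjoin z s t hs ht hsD htD
      have hjm := hmax _ hj (prefixLE_mul_braidLcm (cs.coxeterMatrix_ne_zero s t) hs ht)
      have htj := prefixLE_mul_braidLcm (cs.coxeterMatrix_ne_zero t s) ht hs
      rw [cs.braidLcm_comm] at htj
      have hmm' := hmax' m hm (htj.trans hjm)
      have hjm' := hmax' _ hj htj
      have hm'm := hmax m' hm'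
        ((prefixLE_mul_braidLcm (cs.coxeterMatrix_ne_zero s t) hs ht).trans hjm')
      rw [hmm'.antisymm hm'm]
      exact hmax' y hy hty
    · refine ⟨z, hz, .refl z, fun y hy h => ?_⟩
      by_cases hne : z = y
      · exact hne ▸ .refl z
      obtain ⟨t, ht, hty⟩ := h.exists_simple hne
      exact absurd ⟨t, ht, hdown _ _ hty hy⟩ hex

theorem PrefixLE.mem_parabolic {K : Set B} {x y : W} (h : cs.PrefixLE x y)
    (hy : y ∈ cs.parabolic K) : x ∈ cs.parabolic K := by
  obtain ⟨ω, hω, rfl⟩ := cs.exists_isReduced x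
  obtain ⟨η, hη, he⟩ := cs.exists_isReduced ((cs.wordProd ω)⁻¹ * y)
  have hy' : y = cs.wordProd ω * cs.wordProd η := by rw [← he, mul_inv_cancel_left]
  subst hy'
  have := cs.mem_of_isReduced_of_mem_parabolic
    (cs.isReduced_append hω hη (prefixLE_mul_iff.mp h)) (by rwa [wordProd_append])
  exact cs.wordProd_mem_parabolic fun i hi => this i (List.mem_append_left _ hi)

end WeakOrder

section Longest

variable [Finite W]

theorem exists_longest (K : Set B) :
    ∃ m ∈ cs.parabolic K, ∀ y ∈ cs.parabolic K, cs.PrefixLE y m :=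
  cs.exists_prefixLE_max (D := cs.parabolic K) (Subgroup.one_mem _)
    (fun _ _ h hy => h.mem_parabolic hy) fun z s t hs ht hzs hzt => by
    have hz : z ∈ cs.parabolic K := by
      refine PrefixLE.mem_parabolic (y := z * cs.simple s) ?_ hzs
      rw [prefixLE_mul_iff, hs, cs.length_simple]
    have hs' := cs.simple_mem_parabolic_iff.mp ((Subgroup.mul_mem_cancel_left _ hz).mp hzs)
    have ht' := cs.simple_mem_parabolic_iff.mp ((Subgroup.mul_mem_cancel_left _ hz).mp hzt)
    refine Subgroup.mul_mem _ hz (cs.parabolic_mono ?_ (cs.braidLcm_mem_parabolic s t))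
    rintro i (rfl | rfl) <;> assumption

/-- The longest element of a standard parabolic subgroup. -/
noncomputable def longest (K : Set B) : W := (cs.exists_longest K).choose

theorem longest_mem (K : Set B) : cs.longest K ∈ cs.parabolic K :=
  (cs.exists_longest K).choose_spec.1

variable {cs} {K : Set B}

theorem prefixLE_longest {x : W} (hx : x ∈ cs.parabolic K) : cs.PrefixLE x (cs.longest K) :=
  (cs.exists_longest K).choose_spec.2 x hx

theorem length_mul_longest {x : W} (hx : x ∈ cs.parabolic K) :
    cs.length (x * cs.longest K) + cs.length x = cs.length (cs.longest K) := by
  have := prefixLE_longest (Subgroup.inv_mem _ hx)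
  rw [PrefixLE, inv_inv, cs.length_inv] at this
  omega

theorem longest_inv : (cs.longest K)⁻¹ = cs.longest K := by
  have := length_mul_longest (cs.longest_mem K)
  have h0 : cs.length (cs.longest K * cs.longest K) = 0 := by omega
  rw [cs.length_eq_zero_iff] at h0
  exact inv_eq_of_mul_eq_one_left h0

theorem longest_mul_self : cs.longest K * cs.longest K = 1 := by
  nth_rw 1 [← longest_inv]; exact inv_mul_cancel _

theorem length_longest_mul {x : W} (hx : x ∈ cs.parabolic K) :
    cs.length (cs.longest K * x) + cs.length x = cs.length (cs.longest K) := by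
  have := length_mul_longest (Subgroup.inv_mem _ hx)
  rwa [← cs.length_inv, mul_inv_rev, longest_inv, inv_inv, cs.length_inv] at this

theorem exists_longest_conj {i : B} (hi : i ∈ K) :
    ∃ j ∈ K, cs.longest K * cs.simple i = cs.simple j * cs.longest K := by
  have hi' := cs.simple_mem_parabolic hi
  have hl := cs.longest_mem K
  have h1 := length_mul_longest hi'
  have h2 := length_longest_mul (Subgroup.mul_mem _ hi' hl)
  have h3 : cs.length (cs.longest K * (cs.simple i * cs.longest K)) = 1 := by
    rw [cs.length_simple] at h1
    omega
  obtain ⟨j, hj⟩ := cs.length_eq_one_iff.mp h3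
  refine ⟨j, ?_, ?_⟩
  · rw [← cs.simple_mem_parabolic_iff, ← hj]
    exact Subgroup.mul_mem _ hl (Subgroup.mul_mem _ hi' hl)
  · rw [← hj, mul_assoc, mul_assoc, longest_mul_self, mul_one]

theorem eq_longest {u : W} (hu : u ∈ cs.parabolic K) (h : ∀ i ∈ K, cs.IsLeftDescent u i) :
    u = cs.longest K := by
  have hle := prefixLE_longest (Subgroup.inv_mem _ hu)
  by_contra hne
  obtain ⟨i, hi, hle'⟩ := hle.exists_simple fun h => hne (by rw [← inv_inv u, h, longest_inv])
  have hm := hle'.mem_parabolic (cs.longest_mem K)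
  have hiK := cs.simple_mem_parabolic_iff.mp
    ((Subgroup.mul_mem_cancel_left _ (Subgroup.inv_mem _ hu)).mp hm)
  have hd := h i hiK
  rw [← inv_inv u, isLeftDescent_inv_iff, IsRightDescent] at hd
  omega

theorem longest_prefixLE_of_isLeftDescent {w : W} (h : ∀ i ∈ K, cs.IsLeftDescent w i) :
    cs.PrefixLE (cs.longest K) w := by
  obtain ⟨u, hu, v, hv, rfl⟩ := cs.exists_parabolic_mul_isLeftMin K w
  rw [← eq_longest hu fun i hi => (hv.isLeftDescent_mul_iff hu hi).mp (h i hi), prefixLE_mul_iff]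
  exact hv.length_mul hu

theorem isLeftDescent_longest {i : B} (hi : i ∈ K) : cs.IsLeftDescent (cs.longest K) i := by
  have := length_mul_longest (cs.simple_mem_parabolic hi)
  rw [cs.length_simple] at this
  rw [IsLeftDescent]
  omega

end Longest

end CoxeterSystem

section ArtinMonoid

variable {B : Type*}

/-- One application of a braid relation inside a word. -/
inductive BraidStep (M : CoxeterMatrix B) : List B → List B → Prop
  | braid (s t : B) (l : List B) (h : M s t ≠ 0) :
      BraidStep M (altList s t (M s t) ++ l) (altList t s (M s t) ++ l)
  | cons (i : B) {l l' : List B} (h : BraidStep M l l') : BraidStep M (i :: l) (i :: l')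

namespace BraidStep

variable {M : CoxeterMatrix B}

theorem symm {l l' : List B} (h : BraidStep M l l') : BraidStep M l' l := by
  induction h with
  | braid s t l h =>
    rw [M.symmetric s t] at h ⊢
    exact .braid t s l h
  | cons i _ ih => exact .cons i ih

theorem append_right {l l' : List B} (h : BraidStep M l l') (m : List B) :
    BraidStep M (l ++ m) (l' ++ m) := by
  induction h with
  | braid s t l h => rw [List.append_assoc, List.append_assoc]; exact .braid s t _ h
  | cons i _ ih => exact .cons i ih

theorem append_left {l l' : List B} (h : BraidStep M l l') (m : List B) :
    BraidStep M (m ++ l) (m ++ l') := by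
  induction m with
  | nil => exact h
  | cons i m ih => exact .cons i ih

theorem prod_map_eq {N : Type*} [Monoid N] {f : B → N} (hf : BraidRel M f) {l l' : List B}
    (h : BraidStep M l l') : (l.map f).prod = (l'.map f).prod := by
  induction h with
  | braid s t l h => simp [hf s t h]
  | cons i _ ih => simp [ih]

end BraidStep

/-- The congruence on words generated by the braid relations. -/
def braidCon (M : CoxeterMatrix B) : Con (FreeMonoid B) where
  r l l' := Relation.ReflTransGen (BraidStep M) l.toList l'.toList
  iseqv :=
    { refl := fun _ => .refl
      symm := fun h =>
        letI : Std.Symm (BraidStep M) := ⟨fun _ _ => BraidStep.symm⟩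
        Std.Symm.symm (r := Relation.ReflTransGen (BraidStep M)) _ _ h
      trans := .trans }
  mul' {a b c d} h h' := by
    have h1 : Relation.ReflTransGen (BraidStep M) (a.toList ++ c.toList) (b.toList ++ c.toList) :=
      h.lift (· ++ c.toList) fun _ _ h => h.append_right _
    have h2 : Relation.ReflTransGen (BraidStep M) (b.toList ++ c.toList) (b.toList ++ d.toList) :=
      h'.lift (b.toList ++ ·) fun _ _ h => h.append_left _
    exact h1.trans h2

/-- The Artin monoid of a Coxeter matrix. -/
def ArtinMonoid (M : CoxeterMatrix B) : Type _ := (braidCon M).Quotient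

namespace ArtinMonoid

variable {M : CoxeterMatrix B}

instance : Monoid (ArtinMonoid M) := inferInstanceAs (Monoid (braidCon M).Quotient)

/-- The class of a word in the Artin monoid. -/
def ofWord (l : List B) : ArtinMonoid M := (braidCon M).mk' (FreeMonoid.ofList l)

/-- The generators of the Artin monoid. -/
def atom (M : CoxeterMatrix B) (i : B) : ArtinMonoid M := ofWord [i]

theorem ofWord_eq_ofWord {l l' : List B} :
    (ofWord l : ArtinMonoid M) = ofWord l' ↔ Relation.ReflTransGen (BraidStep M) l l' :=
  (braidCon M).eq

theorem ofWord_append (l l' : List B) : (ofWord (l ++ l') : ArtinMonoid M) = ofWord l * ofWord l' :=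
  rfl

theorem ofWord_cons (i : B) (l : List B) : (ofWord (i :: l) : ArtinMonoid M) = atom M i * ofWord l :=
  rfl

theorem ofWord_nil : (ofWord [] : ArtinMonoid M) = 1 := rfl

theorem exists_ofWord (a : ArtinMonoid M) : ∃ l, a = ofWord l := by
  obtain ⟨l, rfl⟩ := Con.mk'_surjective a
  exact ⟨l.toList, rfl⟩

theorem prod_map_atom (l : List B) : (l.map (atom M)).prod = ofWord l := by
  induction l with
  | nil => rfl
  | cons i l ih => rw [List.map_cons, List.prod_cons, ih, ofWord_cons]

theorem braidRel_atom : BraidRel M (atom M) := fun s t h => by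
  rw [prod_map_atom, prod_map_atom, ofWord_eq_ofWord]
  simpa using Relation.ReflTransGen.single (BraidStep.braid s t [] h)

/-- The universal property of the Artin monoid. -/
def lift {N : Type*} [Monoid N] (f : B → N) (hf : BraidRel M f) : ArtinMonoid M →* N :=
  (braidCon M).lift (FreeMonoid.lift f) fun l l' h => by
    have h : Relation.ReflTransGen (BraidStep M) l.toList l'.toList := h
    have key : ∀ m m', Relation.ReflTransGen (BraidStep M) m m' →
        (m.map f).prod = (m'.map f).prod := fun m m' h => by
      induction h with
      | refl => rfl
      | tail _ h ih => exact ih.trans (h.prod_map_eq hf)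
    rw [Con.ker_rel, FreeMonoid.lift_apply, FreeMonoid.lift_apply]
    exact key _ _ h

theorem lift_ofWord {N : Type*} [Monoid N] (f : B → N) (hf : BraidRel M f) (l : List B) :
    lift f hf (ofWord l) = (l.map f).prod := by
  exact FreeMonoid.lift_apply f (FreeMonoid.ofList l)

theorem lift_atom {N : Type*} [Monoid N] (f : B → N) (hf : BraidRel M f) (i : B) :
    lift f hf (atom M i) = f i := by
  rw [atom, lift_ofWord]; simp

/-- Word length on the Artin monoid, as a homomorphism. -/
def lenHom (M : CoxeterMatrix B) : ArtinMonoid M →* Multiplicative ℕ :=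
  lift (fun _ => Multiplicative.ofAdd 1) fun s t _ => by simp

/-- Word length on the Artin monoid. -/
def len (a : ArtinMonoid M) : ℕ := (lenHom M a).toAdd

@[simp] theorem len_mul (a b : ArtinMonoid M) : len (a * b) = len a + len b := by simp [len]

@[simp] theorem len_one : len (1 : ArtinMonoid M) = 0 := by simp [len]

@[simp] theorem len_ofWord (l : List B) : len (ofWord l : ArtinMonoid M) = l.length := by
  rw [len, lenHom, lift_ofWord _ (fun s t _ => by simp)]
  simp

@[simp] theorem len_atom (i : B) : len (atom M i) = 1 := by simp [atom]

theorem eq_one_of_len {a : ArtinMonoid M} (h : len a = 0) : a = 1 := by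
  obtain ⟨l, rfl⟩ := exists_ofWord a
  rw [len_ofWord, List.length_eq_zero_iff] at h
  rw [h, ofWord_nil]

theorem exists_atom_mul {a : ArtinMonoid M} (h : a ≠ 1) : ∃ i b, a = atom M i * b := by
  obtain ⟨l, rfl⟩ := exists_ofWord a
  cases l with
  | nil => exact absurd ofWord_nil h
  | cons i l => exact ⟨i, ofWord l, ofWord_cons i l⟩

end ArtinMonoid

namespace CoxeterSystem

open ArtinMonoid

variable {W : Type*} [Group W] {M : CoxeterMatrix B} (cs : CoxeterSystem M W)

/-- The canonical section of the Coxeter group in the Artin monoid. -/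
noncomputable def artinLift (w : W) : ArtinMonoid M := cs.braidLift (atom M) w

theorem artinLift_wordProd {ω : List B} (h : cs.IsReduced ω) :
    cs.artinLift (cs.wordProd ω) = ofWord ω := by
  rw [artinLift, cs.braidLift_wordProd braidRel_atom h, prod_map_atom]

@[simp] theorem artinLift_one : cs.artinLift 1 = 1 := cs.braidLift_one braidRel_atom

@[simp] theorem artinLift_simple (i : B) : cs.artinLift (cs.simple i) = atom M i :=
  cs.braidLift_simple braidRel_atom i

theorem artinLift_mul {x y : W} (h : cs.length (x * y) = cs.length x + cs.length y) :
    cs.artinLift (x * y) = cs.artinLift x * cs.artinLift y := cs.braidLift_mul braidRel_atom h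

@[simp] theorem len_artinLift (w : W) : len (cs.artinLift w) = cs.length w := by
  obtain ⟨ω, hω, rfl⟩ := cs.exists_isReduced w
  rw [cs.artinLift_wordProd hω, len_ofWord, hω.eq]

theorem PrefixLE.artinLift {cs : CoxeterSystem M W} {x y : W} (h : cs.PrefixLE x y) :
    cs.artinLift y = cs.artinLift x * cs.artinLift (x⁻¹ * y) := by
  rw [← cs.artinLift_mul (by rwa [mul_inv_cancel_left]), mul_inv_cancel_left]

theorem length_simple_mul_mul {x y : W} {s : B}
    (h : cs.length (x * y) = cs.length x + cs.length y) (hs : cs.IsLeftDescent x s) :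
    cs.length (cs.simple s * x * y) = cs.length (cs.simple s * x) + cs.length y := by
  have h1 := isLeftDescent_mul_of_length h hs
  rw [cs.isLeftDescent_iff] at hs h1
  rw [mul_assoc]
  omega

theorem IsLeftDescent.artinLift {cs : CoxeterSystem M W} {x : W} {s : B}
    (hs : cs.IsLeftDescent x s) :
    cs.artinLift x = atom M s * cs.artinLift (cs.simple s * x) := by
  rw [← cs.artinLift_simple, ← cs.artinLift_mul, cs.simple_mul_simple_cancel_left]
  rw [cs.simple_mul_simple_cancel_left, cs.length_simple, cs.isLeftDescent_iff.mp hs |>.symm]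
  omega

variable {cs}

theorem isLeftDescent_braidLcm {s t : B} (h0 : M s t ≠ 0) :
    cs.IsLeftDescent (cs.braidLcm s t) s := by
  have hr := cs.isReduced_altList h0 le_rfl
  obtain ⟨m, hm⟩ : ∃ m, M s t = m + 1 := Nat.exists_eq_succ_of_ne_zero h0
  rw [braidLcm]
  rw [hm, altList_succ] at hr ⊢
  exact hr.isLeftDescent

theorem artinLift_simple_mul_braidLcm {s t : B} {m : ℕ} (hm : M s t = m + 1) :
    cs.artinLift (cs.simple s * cs.braidLcm s t) = ofWord (altList t s m) := by
  have hr := cs.isReduced_altList (s := s) (t := t) (by omega) le_rfl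
  rw [hm, altList_succ] at hr
  rw [braidLcm, hm, altList_succ, wordProd_cons, cs.simple_mul_simple_cancel_left,
    cs.artinLift_wordProd hr.tail]

variable (cs) in
/-- The common multiple property of the Artin monoid, for multiples of bounded length. -/
def LcmBelow (n : ℕ) : Prop :=
  ∀ (a b : ArtinMonoid M) (s t : B), len a < n → atom M s * a = atom M t * b →
    ∃ c, a = cs.artinLift (cs.simple s * cs.braidLcm s t) * c ∧
      b = cs.artinLift (cs.simple t * cs.braidLcm s t) * c

theorem LcmBelow.cancel_atom {n : ℕ} (h : cs.LcmBelow n) {a b : ArtinMonoid M} {s : B}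
    (ha : len a < n) (hab : atom M s * a = atom M s * b) : a = b := by
  obtain ⟨c, rfl, rfl⟩ := h a b s s ha hab
  rfl

theorem LcmBelow.cancel {n : ℕ} (h : cs.LcmBelow n) {a b : ArtinMonoid M} {z : W}
    (ha : cs.length z + len a ≤ n) (hab : cs.artinLift z * a = cs.artinLift z * b) : a = b := by
  obtain ⟨ω, hω, rfl⟩ := cs.exists_isReduced z
  rw [cs.artinLift_wordProd hω] at hab
  rw [hω.eq] at ha
  clear hω
  induction ω with
  | nil => simpa [ofWord_nil] using hab
  | cons i ω ih =>
    rw [ofWord_cons, mul_assoc, mul_assoc] at hab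
    rw [List.length_cons] at ha
    refine ih (by omega) (h.cancel_atom ?_ hab)
    rw [len_mul, len_ofWord]
    omega

theorem LcmBelow.trans [Finite W] {n : ℕ} (h : cs.LcmBelow n) {c d e : ArtinMonoid M}
    {s t u : B} (he : len e = n) (hc : e = cs.artinLift (cs.simple u * cs.braidLcm u s) * c)
    (hd : e = cs.artinLift (cs.simple u * cs.braidLcm u t) * d) :
    ∃ f, cs.artinLift (cs.simple s * cs.braidLcm u s) * c =
        cs.artinLift (cs.simple s * cs.braidLcm s t) * f ∧
      cs.artinLift (cs.simple t * cs.braidLcm u t) * d =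
        cs.artinLift (cs.simple t * cs.braidLcm s t) * f := by
  have hM := cs.coxeterMatrix_ne_zero
  obtain ⟨v, ⟨hv, f, hf⟩, hmax⟩ := cs.exists_prefixLE_max
    (D := {v | cs.length (cs.simple u * v) = cs.length v + 1 ∧ ∃ g, e = cs.artinLift v * g})
    ⟨by simp, e, by simp⟩
    (fun x y hxy ⟨hy, g, hg⟩ => by
      refine ⟨?_, cs.artinLift (x⁻¹ * y) * g, by rw [hg, ← mul_assoc, ← hxy.artinLift]⟩
      rw [← cs.not_isLeftDescent_iff] at hy ⊢
      intro hx
      have := isLeftDescent_mul_of_length (u := x) (v := x⁻¹ * y)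
        (by rw [mul_inv_cancel_left]; exact hxy) hx
      rw [mul_inv_cancel_left] at this
      exact hy this)
    (fun z i j hi hj ⟨hzi, g, hg⟩ ⟨hzj, g', hg'⟩ => by
      have hz : cs.length (cs.simple u * z) = cs.length z + 1 := by
        rw [← cs.not_isLeftDescent_iff] at hzi ⊢
        exact fun hz => hzi (isLeftDescent_mul_of_length (by rw [hi, cs.length_simple]) hz)
      have hl := length_mul_of_isLeftMin_inv (isLeftMin_inv_pair hi hj)
        (cs.braidLcm_mem_parabolic i j)
      have hl' := length_mul_of_isLeftMin_inv
        (isLeftMin_inv_pair (z := cs.simple u * z) (s := i) (t := j)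
          (by rw [mul_assoc]; omega) (by rw [mul_assoc]; omega))
        (cs.braidLcm_mem_parabolic i j)
      refine ⟨by rw [← mul_assoc]; omega, ?_⟩
      rw [cs.artinLift_mul (by rw [hi, cs.length_simple]), cs.artinLift_simple, mul_assoc] at hg
      rw [cs.artinLift_mul (by rw [hj, cs.length_simple]), cs.artinLift_simple, mul_assoc] at hg'
      have hlen : cs.length z + (1 + len g) = n := by rw [← he, hg]; simp
      have hgg := h.cancel (by simpa using hlen.le) (hg.symm.trans hg')
      obtain ⟨k, hk, -⟩ := h g g' i j (by omega) hgg
      refine ⟨k, ?_⟩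
      rw [cs.artinLift_mul hl, (isLeftDescent_braidLcm (hM i j)).artinLift, hg, hk]
      simp only [mul_assoc])
  have key : ∀ i k, e = cs.artinLift (cs.simple u * cs.braidLcm u i) * k →
      cs.IsLeftDescent (cs.simple u * v) i ∧
      cs.artinLift (cs.simple i * cs.braidLcm u i) * k =
        cs.artinLift (cs.simple i * (cs.simple u * v)) * f := by
    intro i k hk
    have hdu := isLeftDescent_braidLcm (cs := cs) (hM u i)
    have hle := hmax (cs.simple u * cs.braidLcm u i)
      ⟨by rw [cs.simple_mul_simple_cancel_left, cs.isLeftDescent_iff.mp hdu], k, hk⟩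
    obtain ⟨v', rfl⟩ : ∃ v', v = cs.simple u * cs.braidLcm u i * v' :=
      ⟨_, (mul_inv_cancel_left _ _).symm⟩
    have hadd := prefixLE_mul_iff.mp hle
    rw [← mul_assoc, cs.simple_mul_simple_cancel_left] at hv ⊢
    have hadd' : cs.length (cs.braidLcm u i * v') =
        cs.length (cs.braidLcm u i) + cs.length v' := by
      have := cs.isLeftDescent_iff.mp hdu
      omega
    have hdi : cs.IsLeftDescent (cs.braidLcm u i) i := by
      rw [cs.braidLcm_comm]; exact isLeftDescent_braidLcm (hM i u)
    refine ⟨isLeftDescent_mul_of_length hadd' hdi, ?_⟩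
    have hf' := hf
    rw [cs.artinLift_mul hadd, mul_assoc, hk] at hf'
    have hlen : cs.length (cs.simple u * cs.braidLcm u i) + len k = n := by rw [← he, hk]; simp
    rw [h.cancel hlen.le hf', ← mul_assoc, ← mul_assoc,
      cs.artinLift_mul (cs.length_simple_mul_mul hadd' hdi)]
  obtain ⟨hds, hs⟩ := key s c hc
  obtain ⟨hdt, ht⟩ := key t d hd
  obtain ⟨-, -, y, hy, hy'⟩ := hds.exists_braidLcm_mul hdt
  have hadd := hy.length_mul (cs.braidLcm_mem_parabolic s t)
  refine ⟨cs.artinLift y * f, ?_, ?_⟩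
  · rw [hs, hy', ← mul_assoc, ← mul_assoc, cs.artinLift_mul
      (cs.length_simple_mul_mul hadd (isLeftDescent_braidLcm (hM s t)))]
  · rw [ht, hy', ← mul_assoc, ← mul_assoc, cs.artinLift_mul
      (cs.length_simple_mul_mul hadd ?_)]
    rw [cs.braidLcm_comm]
    exact isLeftDescent_braidLcm (hM t s)

theorem lcmBelow [Finite W] (n : ℕ) : cs.LcmBelow n := by
  induction n with
  | zero => exact fun a b s t h => absurd h (Nat.not_lt_zero _)
  | succ n ih =>
    have hM := cs.coxeterMatrix_ne_zero
    intro a b s t ha hab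
    rcases Nat.lt_succ_iff_lt_or_eq.mp ha with ha | ha
    · exact ih a b s t ha hab
    obtain ⟨x, rfl⟩ := exists_ofWord a
    obtain ⟨y, rfl⟩ := exists_ofWord b
    rw [← ofWord_cons, ← ofWord_cons, ofWord_eq_ofWord] at hab
    rw [len_ofWord] at ha
    generalize hl : t :: y = l at hab
    induction hab generalizing t y with
    | refl =>
      obtain ⟨rfl, rfl⟩ := List.cons.inj hl
      exact ⟨ofWord y, by simp [braidLcm_self], by simp [braidLcm_self]⟩
    | @tail l₁ l₂ hchain hstep ihc =>
      subst hl
      have hlen : l₁.length = n + 1 := by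
        have : (ofWord (s :: x) : ArtinMonoid M) = ofWord l₁ := ofWord_eq_ofWord.mpr hchain
        have := congrArg len this
        rw [len_ofWord, len_ofWord, List.length_cons] at this
        omega
      obtain ⟨u, z, rfl⟩ := List.exists_cons_of_length_eq_add_one hlen
      obtain ⟨c, hc, hc'⟩ := ihc u z rfl
      have hd : ∃ d, ofWord z = cs.artinLift (cs.simple u * cs.braidLcm u t) * d ∧
          ofWord y = cs.artinLift (cs.simple t * cs.braidLcm u t) * d := by
        generalize hp : u :: z = p at hstep
        generalize hq : t :: y = q at hstep
        cases hstep with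
        | cons i h =>
          obtain ⟨rfl, rfl⟩ := List.cons.inj hp
          obtain ⟨rfl, rfl⟩ := List.cons.inj hq
          have : (ofWord z : ArtinMonoid M) = ofWord y := ofWord_eq_ofWord.mpr (.single h)
          exact ⟨ofWord y, by simp [braidLcm_self, this], by simp [braidLcm_self]⟩
        | braid u' t' l h =>
          obtain ⟨m, hm⟩ : ∃ m, M u' t' = m + 1 := Nat.exists_eq_succ_of_ne_zero h
          rw [hm, altList_succ, List.cons_append] at hp hq
          obtain ⟨rfl, rfl⟩ := List.cons.inj hp
          obtain ⟨rfl, rfl⟩ := List.cons.inj hq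
          refine ⟨ofWord l, ?_, ?_⟩
          · rw [artinLift_simple_mul_braidLcm hm, ofWord_append]
          · rw [cs.braidLcm_comm, artinLift_simple_mul_braidLcm (by rwa [M.symmetric]),
              ofWord_append]
      obtain ⟨d, hd, hd'⟩ := hd
      rw [cs.braidLcm_comm] at hc'
      obtain ⟨f, hf, hf'⟩ := ih.trans (by rw [len_ofWord]; simpa using hlen) hc' hd
      refine ⟨f, ?_, by rw [hd', hf']⟩
      rw [hc, cs.braidLcm_comm s u, hf]

variable (cs) in
theorem exists_of_atom_mul_eq [Finite W] {a b : ArtinMonoid M} {s t : B}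
    (h : atom M s * a = atom M t * b) :
    ∃ c, a = cs.artinLift (cs.simple s * cs.braidLcm s t) * c ∧
      b = cs.artinLift (cs.simple t * cs.braidLcm s t) * c :=
  cs.lcmBelow (len a + 1) a b s t (Nat.lt_succ_self _) h

end CoxeterSystem

end ArtinMonoid

section Garside

variable {B : Type*}

namespace CoxeterSystem

open ArtinMonoid

variable {W : Type*} [Group W] [Finite W] {M : CoxeterMatrix B} (cs : CoxeterSystem M W)

theorem artin_mul_left_cancel (cs : CoxeterSystem M W) {a b c : ArtinMonoid M} (h : a * b = a * c) :
    b = c := by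
  obtain ⟨l, rfl⟩ := exists_ofWord a
  induction l with
  | nil => simpa [ofWord_nil] using h
  | cons i l ih =>
    rw [ofWord_cons, mul_assoc, mul_assoc] at h
    obtain ⟨d, hd, hd'⟩ := cs.exists_of_atom_mul_eq h
    exact ih (hd.trans hd'.symm)

theorem exists_artinLift_max (g : ArtinMonoid M) :
    ∃ v, cs.artinLift v ∣ g ∧ ∀ x, cs.artinLift x ∣ g → cs.PrefixLE x v := by
  refine cs.exists_prefixLE_max (D := {v | cs.artinLift v ∣ g}) (by simp) ?_ ?_
  · intro x y hxy hy
    exact (Dvd.intro _ hxy.artinLift.symm).trans hy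
  · rintro z i j hi hj ⟨a, ha⟩ ⟨b, hb⟩
    have hl := length_mul_of_isLeftMin_inv (isLeftMin_inv_pair hi hj)
      (cs.braidLcm_mem_parabolic i j)
    rw [cs.artinLift_mul (by rw [hi, cs.length_simple]), cs.artinLift_simple, mul_assoc] at ha
    rw [cs.artinLift_mul (by rw [hj, cs.length_simple]), cs.artinLift_simple, mul_assoc] at hb
    obtain ⟨c, rfl, -⟩ := cs.exists_of_atom_mul_eq (cs.artin_mul_left_cancel (ha.symm.trans hb))
    refine ⟨c, ?_⟩
    rw [cs.artinLift_mul hl, (isLeftDescent_braidLcm (cs.coxeterMatrix_ne_zero i j)).artinLift, ha]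
    simp only [mul_assoc]

/-- The Garside element of a standard parabolic submonoid of the Artin monoid. -/
noncomputable def garside (K : Set B) : ArtinMonoid M := cs.artinLift (cs.longest K)

variable {cs} {K : Set B}

theorem garside_dvd {g : ArtinMonoid M} (h : ∀ i ∈ K, atom M i ∣ g) : cs.garside K ∣ g := by
  obtain ⟨v, hv, hmax⟩ := cs.exists_artinLift_max g
  have hle : cs.PrefixLE (cs.longest K) v := longest_prefixLE_of_isLeftDescent fun i hi => by
    have h1 := hmax (cs.simple i) (by rw [cs.artinLift_simple]; exact h i hi)
    rw [PrefixLE, cs.length_simple, cs.inv_simple] at h1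
    rw [IsLeftDescent]
    omega
  exact (Dvd.intro _ hle.artinLift.symm).trans hv

theorem atom_dvd_garside {i : B} (hi : i ∈ K) : atom M i ∣ cs.garside K :=
  Dvd.intro _ (isLeftDescent_longest hi).artinLift.symm

theorem garside_mul_atom {i j : B} (hi : i ∈ K) (hj : j ∈ K)
    (h : cs.longest K * cs.simple i = cs.simple j * cs.longest K) :
    cs.garside K * atom M i = atom M j * cs.garside K := by
  have h1 : cs.garside K = atom M j * cs.artinLift (cs.simple j * cs.longest K) :=
    (isLeftDescent_longest hj).artinLift
  have h2 : cs.garside K = cs.artinLift (cs.simple j * cs.longest K) * atom M i := by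
    rw [← h, ← cs.artinLift_simple, ← cs.artinLift_mul, cs.simple_mul_simple_cancel_right, garside]
    have := length_longest_mul (cs.simple_mem_parabolic hi)
    rw [cs.simple_mul_simple_cancel_right]
    simpa using this.symm
  rw [h1, mul_assoc, ← h2, ← h1]

theorem commute_garside_sq {i : B} (hi : i ∈ K) : Commute (cs.garside K ^ 2) (atom M i) := by
  obtain ⟨j, hj, h⟩ := exists_longest_conj (cs := cs) hi
  have h' : cs.longest K * cs.simple j = cs.simple i * cs.longest K := by
    have h0 := cs.longest_mul_self (K := K)
    calc cs.longest K * cs.simple j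
        = cs.longest K * (cs.simple j * cs.longest K) * cs.longest K := by
          rw [mul_assoc, mul_assoc, h0, mul_one]
      _ = cs.simple i * cs.longest K := by rw [← h, ← mul_assoc, h0, one_mul]
  rw [Commute, SemiconjBy, sq, mul_assoc, garside_mul_atom hi hj h, ← mul_assoc,
    garside_mul_atom hj hi h', mul_assoc]

theorem commute_garside_univ_sq (a : ArtinMonoid M) : Commute (cs.garside Set.univ ^ 2) a := by
  obtain ⟨l, rfl⟩ := exists_ofWord a
  induction l with
  | nil => exact Commute.one_right _
  | cons i l ih => exact (commute_garside_sq (Set.mem_univ i)).mul_right ih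

theorem exists_dvd_garside_pow (a : ArtinMonoid M) : ∃ n, a ∣ (cs.garside Set.univ ^ 2) ^ n := by
  obtain ⟨l, rfl⟩ := exists_ofWord a
  induction l with
  | nil => exact ⟨0, by rw [pow_zero]; exact dvd_rfl⟩
  | cons i l ih =>
    obtain ⟨n, b, hb⟩ := ih
    obtain ⟨c, hc⟩ := atom_dvd_garside (cs := cs) (Set.mem_univ i)
    refine ⟨n + 1, b * (c * cs.garside Set.univ), ?_⟩
    rw [ofWord_cons, mul_assoc, ← mul_assoc (ofWord l), ← hb,
      ((commute_garside_univ_sq _).pow_left n).eq, ← mul_assoc, ← mul_assoc, ← hc, ← sq, pow_succ']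

end CoxeterSystem

/-- The canonical map from the Artin monoid to the Artin group. -/
def ArtinMonoid.toGroup (M : CoxeterMatrix B) : ArtinMonoid M →* ArtinGroup M :=
  ArtinMonoid.lift (PresentedGroup.of (rels := artinRels M)) <|
    BraidRel.iff_alternatingWord.mpr fun s t h => by
      rcases eq_or_ne s t with rfl | hst
      · rfl
      have := PresentedGroup.one_of_mem (rels := artinRels M)
        (x := altFree s t (M s t) * (altFree t s (M s t))⁻¹) ⟨s, t, hst, h, rfl⟩
      rw [map_mul, map_inv, mul_inv_eq_one, altFree, altFree, map_list_prod, map_list_prod,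
        List.map_map, List.map_map] at this
      exact this

theorem ArtinMonoid.toGroup_atom {M : CoxeterMatrix B} (i : B) :
    ArtinMonoid.toGroup M (ArtinMonoid.atom M i) = PresentedGroup.of i :=
  ArtinMonoid.lift_atom _ _ i

namespace ArtinGroup

variable {M : CoxeterMatrix B}

/-- The universal property of the Artin group. -/
def lift {N : Type*} [Group N] (f : B → N) (hf : BraidRel M f) : ArtinGroup M →* N :=
  PresentedGroup.toGroup (f := f) <| by
    rintro _ ⟨s, t, -, h, rfl⟩
    rw [map_mul, map_inv, mul_inv_eq_one, altFree, altFree, map_list_prod, map_list_prod,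
      List.map_map, List.map_map]
    simpa [Function.comp_def] using BraidRel.iff_alternatingWord.mp hf s t h

theorem lift_toGroup {N : Type*} [Group N] (f : B → N) (hf : BraidRel M f) (a : ArtinMonoid M) :
    lift f hf (ArtinMonoid.toGroup M a) = ArtinMonoid.lift f hf a := by
  obtain ⟨l, rfl⟩ := ArtinMonoid.exists_ofWord a
  rw [ArtinMonoid.toGroup, ArtinMonoid.lift_ofWord, ArtinMonoid.lift_ofWord, map_list_prod,
    List.map_map]
  congr 2
  funext i
  exact PresentedGroup.toGroup.of _

end ArtinGroup

namespace CoxeterSystem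

open ArtinMonoid

variable {W : Type*} [Group W] [Finite W] {M : CoxeterMatrix B} (cs : CoxeterSystem M W)

theorem toGroup_injective (cs : CoxeterSystem M W) :
    Function.Injective (ArtinMonoid.toGroup M) := by
  set z := cs.garside Set.univ ^ 2 with hz
  have hc : ∀ (n : ℕ) a, z ^ n * a = a * z ^ n := fun n a =>
    ((commute_garside_univ_sq a).pow_left n).eq
  have hS : ∀ (s : Submonoid.powers z) a, (s : ArtinMonoid M) * a = a * s := by
    rintro ⟨_, n, rfl⟩ a; exact hc n a
  let _ : OreLocalization.OreSet (Submonoid.powers z) :=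
    { ore_right_cancel := fun r₁ r₂ s h => ⟨s, by rw [hS, hS, h]⟩
      oreNum := fun r _ => r
      oreDenom := fun _ s => s
      ore_eq := fun r s => hS s r }
  let φ : ArtinMonoid M →* OreLocalization (Submonoid.powers z) (ArtinMonoid M) :=
    OreLocalization.numeratorHom
  have hφ : Function.Injective φ := by
    intro a b h
    rw [OreLocalization.numeratorHom_apply, OreLocalization.numeratorHom_apply,
      OreLocalization.oreDiv_eq_iff] at h
    obtain ⟨u, v, h1, h2⟩ := h
    simp only [OneMemClass.coe_one, mul_one] at h2
    rw [Submonoid.smul_def, smul_eq_mul, smul_eq_mul, ← h2] at h1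
    exact (cs.artin_mul_left_cancel h1).symm
  have hzn : ∀ n, IsUnit (φ (z ^ n)) := fun n =>
    OreLocalization.numerator_isUnit (⟨z ^ n, n, rfl⟩ : Submonoid.powers z)
  have hunit : ∀ a, IsUnit (φ a) := by
    intro a
    obtain ⟨n, b, hb⟩ := exists_dvd_garside_pow (cs := cs) a
    have hba : b * a = z ^ n := by
      apply cs.artin_mul_left_cancel (a := a)
      rw [← mul_assoc, ← hb, hc]
    have h1 := hzn n
    rw [hb, map_mul] at h1
    have h2 := hzn n
    rw [← hba, map_mul] at h2
    exact isUnit_iff_exists_and_exists.mpr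
      ⟨⟨φ b * ↑h1.unit⁻¹, by rw [← mul_assoc]; exact h1.mul_val_inv⟩,
        ⟨↑h2.unit⁻¹ * φ b, by rw [mul_assoc]; exact h2.val_inv_mul⟩⟩
  let f : B → (OreLocalization (Submonoid.powers z) (ArtinMonoid M))ˣ := fun i =>
    (hunit (atom M i)).unit
  have hprod : ∀ l : List B, ((l.map f).prod : (OreLocalization (Submonoid.powers z) _)ˣ).val =
      φ (ofWord l) := by
    intro l
    induction l with
    | nil => simp [ofWord_nil]
    | cons i l ih =>
      rw [List.map_cons, List.prod_cons, Units.val_mul, ih, ofWord_cons, map_mul]; rfl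
  have hf : BraidRel M f := fun s t h => by
    ext
    rw [hprod, hprod, ← prod_map_atom, ← prod_map_atom, braidRel_atom s t h]
  intro a b hab
  have := congrArg (ArtinGroup.lift f hf) hab
  obtain ⟨l, rfl⟩ := exists_ofWord a
  obtain ⟨m, rfl⟩ := exists_ofWord b
  rw [ArtinGroup.lift_toGroup, ArtinGroup.lift_toGroup, lift_ofWord, lift_ofWord] at this
  apply hφ
  rw [← hprod, ← hprod, this]

/-- Every element of the Artin group becomes positive after multiplication by a large power of
the square of the Garside element. -/
theorem exists_mul_garside_pow (g : ArtinGroup M) :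
    ∃ n, ∀ m, n ≤ m → ∃ a, g * toGroup M ((cs.garside Set.univ ^ 2) ^ m) = toGroup M a := by
  have hup : ∀ g : ArtinGroup M, (∃ n a, g * toGroup M ((cs.garside Set.univ ^ 2) ^ n) =
      toGroup M a) → ∃ n, ∀ m, n ≤ m → ∃ a,
      g * toGroup M ((cs.garside Set.univ ^ 2) ^ m) = toGroup M a := by
    rintro g ⟨n, a, ha⟩
    refine ⟨n, fun m hm => ⟨a * (cs.garside Set.univ ^ 2) ^ (m - n), ?_⟩⟩
    rw [map_mul, ← ha, mul_assoc, ← map_mul, ← pow_add, Nat.add_sub_cancel' hm]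
  apply hup
  have hg : g ∈ Subgroup.closure (Set.range (PresentedGroup.of (rels := artinRels M))) := by
    rw [PresentedGroup.closure_range_of]; trivial
  induction hg using Subgroup.closure_induction_left with
  | one => exact ⟨0, 1, by simp⟩
  | mul_left x hx y _ ih =>
    obtain ⟨i, rfl⟩ := hx
    obtain ⟨n, a, ha⟩ := ih
    refine ⟨n, atom M i * a, ?_⟩
    rw [mul_assoc, ha, map_mul, toGroup_atom]
  | inv_mul_cancel x hx y _ ih =>
    obtain ⟨i, rfl⟩ := hx
    obtain ⟨n, a, ha⟩ := ih
    obtain ⟨c, hc⟩ := (atom_dvd_garside (cs := cs) (Set.mem_univ i)).trans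
      (dvd_pow_self _ two_ne_zero)
    refine ⟨n + 1, c * a, ?_⟩
    rw [mul_assoc, pow_succ, map_mul, ← mul_assoc y, ha, ← map_mul,
      ← (commute_garside_univ_sq a).eq, hc, mul_assoc, map_mul, toGroup_atom, inv_mul_cancel_left]

end CoxeterSystem

end Garside

section SalvettiComplex

variable {B : Type*}

/-- The incidence sign of adding `s` to the finite set `K`. -/
def incidenceSign [LinearOrder B] (s : B) (K : Finset B) : ℤ := (-1) ^ (K.filter (· < s)).card

theorem incidenceSign_insert [LinearOrder B] {s t : B} {K : Finset B} (ht : t ∉ K) :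
    incidenceSign s (insert t K) = (if t < s then -1 else 1) * incidenceSign s K := by
  rw [incidenceSign, incidenceSign, Finset.filter_insert]
  split_ifs with h
  · rw [Finset.card_insert_of_notMem (by simp [ht]), pow_succ, mul_comm]
  · rw [one_mul]

theorem incidenceSign_eq_one [LinearOrder B] {s : B} {K : Finset B} (h : ∀ t ∈ K, s ≤ t) :
    incidenceSign s K = 1 := by
  rw [incidenceSign, Finset.filter_false_of_mem fun t ht => not_lt.mpr (h t ht)]; simp

theorem incidenceSign_swap [LinearOrder B] {s t : B} {J : Finset B} (hs : s ∈ J) (ht : t ∈ J)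
    (hst : s ≠ t) :
    incidenceSign s (J.erase s) * incidenceSign t ((J.erase s).erase t) =
      -(incidenceSign t (J.erase t) * incidenceSign s ((J.erase t).erase s)) := by
  have h1 : J.erase s = insert t ((J.erase s).erase t) :=
    (Finset.insert_erase (Finset.mem_erase.mpr ⟨hst.symm, ht⟩)).symm
  have h2 : J.erase t = insert s ((J.erase s).erase t) := by
    rw [Finset.erase_right_comm]; exact (Finset.insert_erase (Finset.mem_erase.mpr ⟨hst, hs⟩)).symm
  rw [Finset.erase_right_comm (a := t)]
  have e1 := incidenceSign_insert (s := s) (t := t) (K := (J.erase s).erase t) (by simp)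
  have e2 := incidenceSign_insert (s := t) (t := s) (K := (J.erase s).erase t) (by simp)
  rw [← h1] at e1
  rw [← h2] at e2
  rw [e1, e2]
  rcases lt_or_gt_of_ne hst with h | h
  · rw [if_neg h.not_gt, if_pos h]; ring
  · rw [if_neg h.not_gt, if_pos h]; ring

/-- The chains of the Salvetti complex with coefficients in a monoid. -/
abbrev SalvettiChain (B N : Type*) : Type _ := (Finset B × N) →₀ ℤ

/-- The augmentation of the Salvetti complex. -/
noncomputable def augmentation (B N : Type*) [DecidableEq B] : SalvettiChain B N →ₗ[ℤ] ℤ :=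
  Finsupp.linearCombination ℤ fun b => if b.1 = ∅ then 1 else 0

@[simp] theorem augmentation_single [DecidableEq B] {N : Type*} (b : Finset B × N) :
    augmentation B N (Finsupp.single b 1) = if b.1 = ∅ then 1 else 0 := by
  rw [augmentation, Finsupp.linearCombination_single, one_smul]

theorem augmentation_mapDomain [DecidableEq B] {N N' : Type*} (ψ : N → N') (c : SalvettiChain B N) :
    augmentation B N' (Finsupp.mapDomain (Prod.map id ψ) c) = augmentation B N c := by
  suffices hc : augmentation B N' ∘ₗ Finsupp.lmapDomain ℤ ℤ (Prod.map id ψ) = augmentation B N from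
    LinearMap.congr_fun hc c
  refine Finsupp.lhom_ext' fun ⟨J, n⟩ => LinearMap.ext_ring ?_
  simp

namespace CoxeterSystem

open ArtinMonoid

variable {W : Type*} [Group W] {M : CoxeterMatrix B} {cs : CoxeterSystem M W}

theorem IsLeftMin.mul_left_injective {K : Set B} {u u' v v' : W} (hu : u ∈ cs.parabolic K)
    (hu' : u' ∈ cs.parabolic K) (hv : cs.IsLeftMin K v) (hv' : cs.IsLeftMin K v')
    (h : u * v = u' * v') : u = u' := by
  have hm := Subgroup.mul_mem _ (Subgroup.inv_mem _ hu) hu'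
  have h1 : v = u⁻¹ * u' * v' := by rw [mul_assoc, ← h, inv_mul_cancel_left]
  have h2 : v' = (u⁻¹ * u')⁻¹ * v := by rw [h1, inv_mul_cancel_left]
  have h3 := hv'.length_mul hm
  have h4 := hv.length_mul (Subgroup.inv_mem _ hm)
  rw [← h1] at h3
  rw [← h2] at h4
  have h0 : cs.length (u⁻¹ * u') = 0 := by omega
  rwa [cs.length_eq_zero_iff, inv_mul_eq_one] at h0

variable [Finite W]

variable (cs) in
/-- The minimal coset representatives of `W_K` in `W_L`. -/
noncomputable def minReps (K L : Finset B) : Finset W :=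
  (Set.toFinite {x | x ∈ cs.parabolic (L : Set B) ∧ cs.IsLeftMin (K : Set B) x}).toFinset

theorem mem_minReps {K L : Finset B} {x : W} :
    x ∈ cs.minReps K L ↔ x ∈ cs.parabolic (L : Set B) ∧ cs.IsLeftMin (K : Set B) x := by
  simp [minReps]

variable (cs) in
/-- The sign attached to a minimal coset representative. -/
noncomputable def repSign (K L : Finset B) (x : W) : ℤ :=
  (-1) ^ (cs.length (cs.longest (K : Set B)) + cs.length x + cs.length (cs.longest (L : Set B)))

theorem repSign_mul {P K L : Finset B} {x y : W}
    (h : cs.length (y * x) = cs.length y + cs.length x) :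
    cs.repSign K L x * cs.repSign P K y = cs.repSign P L (y * x) := by
  rw [repSign, repSign, repSign, h, ← pow_add]
  have : ∀ a b c d e : ℕ, (-1 : ℤ) ^ (a + b + c + (d + e + a)) = (-1) ^ (d + (e + b) + c) := by
    intro a b c d e
    rw [show a + b + c + (d + e + a) = d + (e + b) + c + 2 * a by ring, pow_add _ _ (2 * a),
      pow_mul]
    simp
  exact this _ _ _ _ _

variable {N : Type*} [Monoid N]

variable (cs) in
/-- The part of the boundary of a cell labelled `L` which consists of cells labelled `K`. -/
noncomputable def salvettiBlock (φ : ArtinMonoid M →* N) (K L : Finset B) (n : N) :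
    SalvettiChain B N :=
  ∑ x ∈ cs.minReps K L, cs.repSign K L x • Finsupp.single (K, φ (cs.artinLift x) * n) (1 : ℤ)

theorem sum_salvettiBlock (φ : ArtinMonoid M →* N) {P K L : Finset B} (hPK : P ⊆ K) (hKL : K ⊆ L)
    (n : N) :
    ∑ x ∈ cs.minReps K L, cs.repSign K L x •
      cs.salvettiBlock φ P K (φ (cs.artinLift x) * n) = cs.salvettiBlock φ P L n := by
  have hKL' : (K : Set B) ⊆ L := by exact_mod_cast hKL
  have hPK' : (P : Set B) ⊆ K := by exact_mod_cast hPK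
  simp only [salvettiBlock, Finset.smul_sum, smul_smul]
  rw [Finset.sum_sigma']
  refine Finset.sum_nbij (fun p => p.2 * p.1) ?_ ?_ ?_ ?_
  · rintro ⟨x, y⟩ h
    simp only [Finset.mem_sigma, mem_minReps] at h ⊢
    obtain ⟨⟨hx, hx'⟩, hy, hy'⟩ := h
    exact ⟨Subgroup.mul_mem _ (cs.parabolic_mono hKL' hy) hx, fun i hi hd =>
      hy' i hi ((hx'.isLeftDescent_mul_iff hy (hPK' hi)).mp hd)⟩
  · rintro ⟨x, y⟩ h ⟨x', y'⟩ h' he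
    simp only [Finset.mem_coe, Finset.mem_sigma, mem_minReps] at h h'
    obtain rfl : y = y' := h.1.2.mul_left_injective h.2.1 h'.2.1 h'.1.2 he
    obtain rfl : x = x' := mul_left_cancel he
    rfl
  · intro w hw
    rw [Finset.mem_coe, mem_minReps] at hw
    obtain ⟨y, hy, x, hx, rfl⟩ := cs.exists_parabolic_mul_isLeftMin K w
    refine ⟨⟨x, y⟩, ?_, rfl⟩
    simp only [Finset.mem_coe, Finset.mem_sigma, mem_minReps]
    refine ⟨⟨(Subgroup.mul_mem_cancel_left _ (cs.parabolic_mono hKL' hy)).mp hw.1, hx⟩, hy,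
      fun i hi hd => hw.2 i hi ((hx.isLeftDescent_mul_iff hy (hPK' hi)).mpr hd)⟩
  · rintro ⟨x, y⟩ h
    simp only [Finset.mem_sigma, mem_minReps] at h
    have hl := h.1.2.length_mul h.2.1
    rw [repSign_mul hl, cs.artinLift_mul hl, map_mul, mul_assoc]

variable [LinearOrder B]

variable (cs) in
/-- The boundary of a cell. -/
noncomputable def cellBoundary (φ : ArtinMonoid M →* N) (b : Finset B × N) : SalvettiChain B N :=
  ∑ s ∈ b.1, incidenceSign s (b.1.erase s) • cs.salvettiBlock φ (b.1.erase s) b.1 b.2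

variable (cs) in
/-- The boundary operator of the Salvetti complex. -/
noncomputable def boundary (φ : ArtinMonoid M →* N) : SalvettiChain B N →ₗ[ℤ] SalvettiChain B N :=
  Finsupp.linearCombination ℤ (cs.cellBoundary φ)

@[simp] theorem boundary_single (φ : ArtinMonoid M →* N) (b : Finset B × N) :
    cs.boundary φ (Finsupp.single b 1) = cs.cellBoundary φ b := by
  rw [boundary, Finsupp.linearCombination_single, one_smul]

theorem boundary_boundary (φ : ArtinMonoid M →* N) (c : SalvettiChain B N) :
    cs.boundary φ (cs.boundary φ c) = 0 := by
  suffices h : cs.boundary φ ∘ₗ cs.boundary φ = 0 from LinearMap.congr_fun h c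
  refine Finsupp.lhom_ext' fun ⟨J, n⟩ => LinearMap.ext_ring ?_
  have h1 : ∀ s ∈ J, cs.boundary φ (cs.salvettiBlock φ (J.erase s) J n) =
      ∑ t ∈ J.erase s, incidenceSign t ((J.erase s).erase t) •
        cs.salvettiBlock φ ((J.erase s).erase t) J n := by
    intro s _
    rw [salvettiBlock, map_sum]
    simp only [map_smul, boundary_single, cellBoundary, Finset.smul_sum]
    rw [Finset.sum_comm]
    refine Finset.sum_congr rfl fun t _ => ?_
    simp only [smul_comm (cs.repSign _ _ _)]
    rw [← Finset.smul_sum, sum_salvettiBlock φ (Finset.erase_subset _ _) (Finset.erase_subset _ _)]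
  simp only [LinearMap.coe_comp, Function.comp_apply, Finsupp.lsingle_apply, boundary_single,
    LinearMap.zero_apply, LinearMap.zero_comp]
  rw [cellBoundary, map_sum]
  simp only [map_smul]
  rw [Finset.sum_congr rfl fun s hs => by rw [h1 s hs]]
  simp only [Finset.smul_sum, smul_smul]
  rw [Finset.sum_sigma']
  refine Finset.sum_involution (fun p _ => ⟨p.2, p.1⟩) ?_ ?_ ?_ ?_
  · rintro ⟨s, t⟩ h
    simp only [Finset.mem_sigma, Finset.mem_erase] at h
    dsimp only
    rw [incidenceSign_swap h.1 h.2.2 (Ne.symm h.2.1), neg_smul, Finset.erase_right_comm (a := s),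
      neg_add_cancel]
  · rintro ⟨s, t⟩ h - he
    simp only [Finset.mem_sigma, Finset.mem_erase] at h
    exact h.2.1 (Sigma.mk.inj he).1
  · rintro ⟨s, t⟩ h
    simp only [Finset.mem_sigma, Finset.mem_erase] at h ⊢
    exact ⟨h.2.2, h.2.1.symm, h.1⟩
  · rintro ⟨s, t⟩ h
    rfl

theorem augmentation_boundary (φ : ArtinMonoid M →* N) (c : SalvettiChain B N) :
    augmentation B N (cs.boundary φ c) = 0 := by
  suffices h : augmentation B N ∘ₗ cs.boundary φ = 0 from LinearMap.congr_fun h c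
  refine Finsupp.lhom_ext' fun ⟨J, n⟩ => LinearMap.ext_ring ?_
  simp only [LinearMap.coe_comp, Function.comp_apply, Finsupp.lsingle_apply, boundary_single,
    LinearMap.zero_apply, LinearMap.zero_comp]
  rw [cellBoundary, map_sum]
  refine Finset.sum_eq_zero fun s hs => ?_
  rw [map_smul, salvettiBlock, map_sum]
  simp only [map_smul, augmentation_single]
  by_cases hJ : J.erase s = ∅
  · suffices h : ∑ x ∈ cs.minReps (J.erase s) J, cs.repSign (J.erase s) J x = 0 by
      simp [hJ] at h ⊢
      exact Or.inr h
    have hmem : ∀ x, x ∈ cs.minReps (J.erase s) J ↔ x ∈ cs.parabolic (J : Set B) := by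
      intro x
      rw [mem_minReps, hJ]
      simp [IsLeftMin]
    have hs' := cs.simple_mem_parabolic (K := (J : Set B)) (i := s) (by exact_mod_cast hs)
    refine Finset.sum_involution (fun x _ => cs.simple s * x) ?_ ?_ ?_ ?_
    · intro x _
      rw [repSign, repSign]
      rcases cs.length_simple_mul x s with h | h
      · rw [h, show ∀ a b c : ℕ, a + (b + 1) + c = a + b + c + 1 by intros; ring, pow_succ]
        ring
      · rw [← h, show ∀ a b c : ℕ, a + (b + 1) + c = a + b + c + 1 by intros; ring, pow_succ]
        ring
    · intro x _ _ he
      exact cs.length_simple_mul_ne x s (congrArg cs.length he)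
    · intro x hx
      rw [hmem] at hx ⊢
      exact Subgroup.mul_mem _ hs' hx
    · intro x _
      exact cs.simple_mul_simple_cancel_left s
  · simp [hJ]

theorem boundary_mapDomain {N' : Type*} [Monoid N'] {φ : ArtinMonoid M →* N}
    {φ' : ArtinMonoid M →* N'} {ψ : N → N'} (h : ∀ a n, ψ (φ a * n) = φ' a * ψ n)
    (c : SalvettiChain B N) :
    cs.boundary φ' (Finsupp.mapDomain (Prod.map id ψ) c) =
      Finsupp.mapDomain (Prod.map id ψ) (cs.boundary φ c) := by
  suffices hc : cs.boundary φ' ∘ₗ Finsupp.lmapDomain ℤ ℤ (Prod.map id ψ) =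
      Finsupp.lmapDomain ℤ ℤ (Prod.map id ψ) ∘ₗ cs.boundary φ from LinearMap.congr_fun hc c
  refine Finsupp.lhom_ext' fun ⟨J, n⟩ => LinearMap.ext_ring ?_
  simp only [LinearMap.coe_comp, Function.comp_apply, Finsupp.lsingle_apply, boundary_single,
    Finsupp.lmapDomain_apply, Finsupp.mapDomain_single, Prod.map_apply, id]
  rw [← Finsupp.lmapDomain_apply ℤ ℤ]
  simp only [cellBoundary, salvettiBlock, map_sum, map_smul, Finsupp.lmapDomain_apply,
    Finsupp.mapDomain_single, Prod.map_apply, id, h]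

end CoxeterSystem

end SalvettiComplex

section Contraction

variable {B : Type*}

namespace CoxeterSystem

open ArtinMonoid

variable {W : Type*} [Group W] [Finite W] {M : CoxeterMatrix B} {cs : CoxeterSystem M W}

theorem len_garside (K : Set B) : len (cs.garside K) = cs.length (cs.longest K) :=
  cs.len_artinLift _

theorem garside_mul_longest_mul {K L : Set B} (h : K ⊆ L) :
    cs.garside K * cs.artinLift (cs.longest K * cs.longest L) = cs.garside L := by
  have := (prefixLE_longest (cs.parabolic_mono h (cs.longest_mem K))).artinLift
  rw [cs.longest_inv] at this
  exact this.symm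

theorem garside_dvd_garside {K L : Set B} (h : K ⊆ L) : cs.garside K ∣ cs.garside L :=
  Dvd.intro _ (garside_mul_longest_mul h)

theorem longest_mul_longest_mem_minReps {K L : Finset B} (h : K ⊆ L) :
    cs.longest (K : Set B) * cs.longest (L : Set B) ∈ cs.minReps K L := by
  have h' : (K : Set B) ⊆ L := by exact_mod_cast h
  rw [mem_minReps]
  refine ⟨Subgroup.mul_mem _ (cs.parabolic_mono h' (cs.longest_mem _)) (cs.longest_mem _), ?_⟩
  refine isLeftMin_of_length_mul fun x hx => ?_
  have h1 := length_mul_longest (cs.parabolic_mono h' (cs.longest_mem K))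
  have h2 := length_mul_longest
    (cs.parabolic_mono h' (Subgroup.mul_mem _ hx (cs.longest_mem (K : Set B))))
  have h3 := length_mul_longest hx
  rw [mul_assoc] at h2
  omega

/-- The total weight of a cell. -/
noncomputable def cellWeight (cs : CoxeterSystem M W) (b : Finset B × ArtinMonoid M) : ℕ :=
  len (cs.garside (b.1 : Set B) * b.2)

variable (cs) in
/-- The chains supported on cells of weight less than `p`. -/
def lowerChains (p : ℕ) : Submodule ℤ (SalvettiChain B (ArtinMonoid M)) :=
  Finsupp.supported ℤ ℤ {b | cs.cellWeight b < p}

theorem single_mem_lowerChains {p : ℕ} {b : Finset B × ArtinMonoid M} (h : cs.cellWeight b < p) :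
    Finsupp.single b 1 ∈ cs.lowerChains p := Finsupp.single_mem_supported ℤ _ h

theorem lowerChains_mono {p q : ℕ} (h : p ≤ q) : cs.lowerChains p ≤ cs.lowerChains q :=
  Finsupp.supported_mono fun _ hb => lt_of_lt_of_le hb h

/-- Linear maps can be tested for membership on cells of bounded weight. -/
theorem map_mem_of_mem_lowerChains {V : Type*} [AddCommGroup V] {p : ℕ} {U : Submodule ℤ V}
    {f : SalvettiChain B (ArtinMonoid M) →ₗ[ℤ] V}
    (h : ∀ b, cs.cellWeight b < p → f (Finsupp.single b 1) ∈ U)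
    {c : SalvettiChain B (ArtinMonoid M)} (hc : c ∈ cs.lowerChains p) : f c ∈ U := by
  rw [lowerChains, Finsupp.supported_eq_span_single] at hc
  have : Submodule.span ℤ ((fun b => Finsupp.single b (1 : ℤ)) '' {b | cs.cellWeight b < p}) ≤
      U.comap f := by
    rw [Submodule.span_le]
    rintro _ ⟨b, hb, rfl⟩
    exact h b hb
  exact this hc

open scoped Classical in
variable (cs) in
/-- The cell with label `J` and top vertex `x`, if it exists. -/
noncomputable def topCell (x : ArtinMonoid M) (J : Finset B) : SalvettiChain B (ArtinMonoid M) :=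
  if h : ∃ m, x = cs.garside (J : Set B) * m then Finsupp.single (J, h.choose) 1 else 0

theorem topCell_garside_mul (J : Finset B) (m : ArtinMonoid M) :
    cs.topCell (cs.garside (J : Set B) * m) J = Finsupp.single (J, m) 1 := by
  have h : ∃ m', cs.garside (J : Set B) * m = cs.garside (J : Set B) * m' := ⟨m, rfl⟩
  rw [topCell, dif_pos h, ← cs.artin_mul_left_cancel h.choose_spec]

theorem topCell_mem_lowerChains {x : ArtinMonoid M} {J : Finset B} {p : ℕ} (h : len x < p) :
    cs.topCell x J ∈ cs.lowerChains p := by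
  by_cases hx : cs.garside (J : Set B) ∣ x
  · obtain ⟨m, rfl⟩ := hx
    rw [topCell_garside_mul]
    exact single_mem_lowerChains h
  · rw [topCell, dif_neg (show ¬ ∃ m, x = cs.garside (J : Set B) * m from hx)]
    exact zero_mem _

theorem salvettiBlock_sub_topCell_mem {K L : Finset B} (h : K ⊆ L) (m : ArtinMonoid M) :
    cs.salvettiBlock (MonoidHom.id _) K L m - cs.topCell (cs.garside (L : Set B) * m) K ∈
      cs.lowerChains (len (cs.garside (L : Set B) * m)) := by
  classical
  have h' : (K : Set B) ⊆ L := by exact_mod_cast h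
  rw [← garside_mul_longest_mul h', mul_assoc, topCell_garside_mul, salvettiBlock,
    ← Finset.add_sum_erase _ _ (longest_mul_longest_mem_minReps h)]
  have h1 := length_mul_longest (cs.parabolic_mono h' (cs.longest_mem K))
  have hsign : cs.repSign K L (cs.longest (K : Set B) * cs.longest (L : Set B)) = 1 := by
    rw [repSign, add_comm (cs.length (cs.longest (K : Set B))), h1, ← two_mul, pow_mul]
    simp
  rw [hsign, one_smul, MonoidHom.id_apply, add_sub_cancel_left]
  refine Submodule.sum_mem _ fun x hx => Submodule.smul_mem _ _ (single_mem_lowerChains ?_)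
  rw [Finset.mem_erase, mem_minReps] at hx
  obtain ⟨hne, hxL, hxK⟩ := hx
  have h2 := hxK.length_mul (cs.longest_mem (K : Set B))
  have h3 := prefixLE_longest
    (Subgroup.mul_mem _ (cs.parabolic_mono h' (cs.longest_mem (K : Set B))) hxL)
  have h4 : cs.length ((cs.longest (K : Set B) * x)⁻¹ * cs.longest (L : Set B)) ≠ 0 := by
    rw [Ne, cs.length_eq_zero_iff, inv_mul_eq_one]
    intro he
    apply hne
    rw [← he, ← mul_assoc, cs.longest_mul_self, one_mul]
  rw [PrefixLE] at h3
  simp only [cellWeight, len_mul, MonoidHom.id_apply, len_garside, len_artinLift]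
  omega

variable [LinearOrder B]

theorem boundary_topCell_sub_mem {x : ArtinMonoid M} {J : Finset B}
    (h : cs.garside (J : Set B) ∣ x) :
    cs.boundary (MonoidHom.id _) (cs.topCell x J) -
      ∑ s ∈ J, incidenceSign s (J.erase s) • cs.topCell x (J.erase s) ∈
        cs.lowerChains (len x) := by
  obtain ⟨m, rfl⟩ := h
  rw [topCell_garside_mul, boundary_single, cellBoundary, ← Finset.sum_sub_distrib]
  refine Submodule.sum_mem _ fun s _ => ?_
  rw [← smul_sub]
  exact Submodule.smul_mem _ _ (salvettiBlock_sub_topCell_mem (Finset.erase_subset _ _) m)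

open scoped Classical in
variable (cs) in
/-- The contracting homotopy on a cell: add the least generator dividing the top vertex. -/
noncomputable def cellHomotopy (b : Finset B × ArtinMonoid M) : SalvettiChain B (ArtinMonoid M) :=
  if h : ∃ s, IsLeast {i | atom M i ∣ cs.garside (b.1 : Set B) * b.2} s then
    if h.choose ∈ b.1 then 0
    else cs.topCell (cs.garside (b.1 : Set B) * b.2) (insert h.choose b.1)
  else 0

variable (cs) in
/-- The contracting homotopy of the Salvetti complex of the Artin monoid, up to lower terms. -/
noncomputable def homotopy :
    SalvettiChain B (ArtinMonoid M) →ₗ[ℤ] SalvettiChain B (ArtinMonoid M) :=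
  Finsupp.linearCombination ℤ cs.cellHomotopy

theorem homotopy_topCell {x : ArtinMonoid M} {J : Finset B} {s : B}
    (h : cs.garside (J : Set B) ∣ x) (hs : IsLeast {i | atom M i ∣ x} s) :
    cs.homotopy (cs.topCell x J) = if s ∈ J then 0 else cs.topCell x (insert s J) := by
  obtain ⟨m, rfl⟩ := h
  rw [topCell_garside_mul, homotopy, Finsupp.linearCombination_single, one_smul]
  have h : ∃ s, IsLeast {i | atom M i ∣ cs.garside (J : Set B) * m} s := ⟨s, hs⟩
  rw [cellHomotopy, dif_pos h, h.choose_spec.unique hs]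

theorem homotopy_mem_lowerChains {p : ℕ} {c : SalvettiChain B (ArtinMonoid M)}
    (hc : c ∈ cs.lowerChains p) : cs.homotopy c ∈ cs.lowerChains p := by
  refine map_mem_of_mem_lowerChains (fun b hb => ?_) hc
  rw [homotopy, Finsupp.linearCombination_single, one_smul, cellHomotopy]
  split_ifs
  · exact zero_mem _
  · exact topCell_mem_lowerChains hb
  · exact zero_mem _

theorem boundary_mem_lowerChains {p : ℕ} {c : SalvettiChain B (ArtinMonoid M)}
    (hc : c ∈ cs.lowerChains p) : cs.boundary (MonoidHom.id _) c ∈ cs.lowerChains p := by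
  refine map_mem_of_mem_lowerChains (fun b hb => ?_) hc
  obtain ⟨J, m⟩ := b
  rw [← topCell_garside_mul (cs := cs)]
  have := boundary_topCell_sub_mem (cs := cs) (dvd_mul_right (cs.garside (J : Set B)) m)
  rw [← sub_add_cancel (cs.boundary _ _)]
  refine Submodule.add_mem _ (lowerChains_mono hb.le this) ?_
  exact Submodule.sum_mem _ fun s _ => Submodule.smul_mem _ _ (topCell_mem_lowerChains hb)

theorem homotopy_spec_topCell {x : ArtinMonoid M} {J : Finset B} {s : B}
    (h : cs.garside (J : Set B) ∣ x) (hs : IsLeast {i | atom M i ∣ x} s) :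
    cs.boundary (MonoidHom.id _) (cs.homotopy (cs.topCell x J)) +
      cs.homotopy (cs.boundary (MonoidHom.id _) (cs.topCell x J)) - cs.topCell x J ∈
        cs.lowerChains (len x) := by
  have hsub : ∀ t : B, cs.garside ((J.erase t : Finset B) : Set B) ∣ x := fun t =>
    (garside_dvd_garside (by exact_mod_cast Finset.erase_subset t J)).trans h
  have hle : ∀ t ∈ J, s ≤ t := fun t ht => hs.2
    ((atom_dvd_garside (cs := cs) (K := (J : Set B)) (by exact_mod_cast ht)).trans h)
  have hr := homotopy_mem_lowerChains (boundary_topCell_sub_mem h)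
  rw [map_sub, map_sum] at hr
  simp only [map_smul] at hr
  rw [homotopy_topCell h hs]
  split_ifs with hsJ
  · rw [map_zero, zero_add]
    convert hr using 2
    rw [Finset.sum_eq_single_of_mem s hsJ]
    · rw [homotopy_topCell (hsub s) hs, if_neg (by simp), Finset.insert_erase hsJ,
        incidenceSign_eq_one fun t ht => hle t (Finset.mem_of_mem_erase ht), one_smul]
    · intro t ht hts
      rw [homotopy_topCell (hsub t) hs, if_pos (Finset.mem_erase.mpr ⟨hts.symm, hsJ⟩), smul_zero]
  · have hins : cs.garside ((insert s J : Finset B) : Set B) ∣ x := by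
      refine garside_dvd fun i hi => ?_
      rw [Finset.mem_coe, Finset.mem_insert] at hi
      rcases hi with rfl | hi
      · exact hs.1
      · exact (atom_dvd_garside (by exact_mod_cast hi)).trans h
    have hd := boundary_topCell_sub_mem hins
    rw [Finset.sum_insert hsJ, Finset.erase_insert hsJ, incidenceSign_eq_one hle, one_smul] at hd
    convert Submodule.add_mem _ hd hr using 1
    have hcancel : ∑ t ∈ J, incidenceSign t ((insert s J).erase t) •
          cs.topCell x ((insert s J).erase t) =
        -∑ t ∈ J, incidenceSign t (J.erase t) • cs.homotopy (cs.topCell x (J.erase t)) := by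
      rw [← Finset.sum_neg_distrib]
      refine Finset.sum_congr rfl fun t ht => ?_
      have hst : s ≠ t := fun h => hsJ (h ▸ ht)
      rw [homotopy_topCell (hsub t) hs, if_neg (fun h => hsJ (Finset.mem_of_mem_erase h)),
        Finset.erase_insert_of_ne hst,
        incidenceSign_insert (fun h => hsJ (Finset.mem_of_mem_erase h)),
        if_pos (lt_of_le_of_ne (hle t ht) hst), neg_one_mul, neg_smul]
    rw [hcancel]
    abel

theorem eq_smul_of_mem_lowerChains_one {c : SalvettiChain B (ArtinMonoid M)}
    (hc : c ∈ cs.lowerChains 1) : c = augmentation B _ c • Finsupp.single (∅, 1) 1 := by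
  have := map_mem_of_mem_lowerChains (U := ⊥) (f := LinearMap.id -
    (augmentation B (ArtinMonoid M)).smulRight (Finsupp.single (∅, 1) 1)) (fun b hb => ?_) hc
  · simpa [sub_eq_zero] using this
  · obtain ⟨J, m⟩ := b
    rw [cellWeight, Nat.lt_one_iff, len_mul, Nat.add_eq_zero_iff] at hb
    obtain rfl := eq_one_of_len hb.2
    obtain rfl : J = ∅ := by
      refine Finset.eq_empty_of_forall_notMem fun i hi => ?_
      have := isLeftDescent_longest (cs := cs) (K := (J : Set B)) (i := i) (by exact_mod_cast hi)
      have h0 := hb.1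
      rw [len_garside] at h0
      rw [IsLeftDescent, h0] at this
      exact Nat.not_lt_zero _ this
    simp

theorem boundary_mapDomain_mul_right (g : ArtinGroup M) (c : SalvettiChain B (ArtinGroup M)) :
    cs.boundary (toGroup M) (Finsupp.mapDomain (Prod.map id (· * g)) c) =
      Finsupp.mapDomain (Prod.map id (· * g)) (cs.boundary (toGroup M) c) :=
  boundary_mapDomain (fun _ _ => mul_assoc _ _ _) c

variable [Finite B]

theorem homotopy_spec {q : ℕ} {c : SalvettiChain B (ArtinMonoid M)}
    (hc : c ∈ cs.lowerChains (q + 2)) :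
    cs.boundary (MonoidHom.id _) (cs.homotopy c) +
        cs.homotopy (cs.boundary (MonoidHom.id _) c) - c ∈
      cs.lowerChains (q + 1) := by
  refine map_mem_of_mem_lowerChains (f := cs.boundary (MonoidHom.id _) ∘ₗ cs.homotopy +
    cs.homotopy ∘ₗ cs.boundary (MonoidHom.id _) - LinearMap.id) (fun b hb => ?_) hc
  simp only [LinearMap.sub_apply, LinearMap.add_apply, LinearMap.comp_apply, LinearMap.id_apply]
  rcases Nat.lt_succ_iff_lt_or_eq.mp hb with hb | hb
  · have h1 := single_mem_lowerChains hb
    exact Submodule.sub_mem _ (Submodule.add_mem _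
      (boundary_mem_lowerChains (homotopy_mem_lowerChains h1))
      (homotopy_mem_lowerChains (boundary_mem_lowerChains h1))) h1
  · obtain ⟨J, m⟩ := b
    have hx : cs.garside (J : Set B) * m ≠ 1 := by
      intro h
      rw [cellWeight, h, len_one] at hb
      omega
    obtain ⟨i, a, hi⟩ := exists_atom_mul hx
    obtain ⟨s, hs⟩ := (Set.toFinite {i | atom M i ∣ cs.garside (J : Set B) * m}).exists_minimal
      ⟨i, a, hi⟩
    have hs' : IsLeast {i | atom M i ∣ cs.garside (J : Set B) * m} s :=
      ⟨hs.1, fun t ht => (le_total s t).elim id fun h => hs.2 ht h⟩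
    rw [← topCell_garside_mul (cs := cs), ← hb]
    exact homotopy_spec_topCell (dvd_mul_right (cs.garside (J : Set B)) m) hs'

theorem exists_boundary_eq_of_mem_lowerChains (p : ℕ) :
    ∀ c ∈ cs.lowerChains (p + 1), cs.boundary (MonoidHom.id _) c = 0 →
      augmentation B _ c = 0 → ∃ y, cs.boundary (MonoidHom.id _) y = c := by
  induction p with
  | zero =>
    intro c hc _ h0
    refine ⟨0, ?_⟩
    rw [map_zero, eq_smul_of_mem_lowerChains_one hc, h0, zero_smul]
  | succ p ih =>
    intro c hc hd h0
    have h1 := homotopy_spec hc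
    rw [hd, map_zero, add_zero] at h1
    obtain ⟨y, hy⟩ := ih _ h1 (by rw [map_sub, boundary_boundary, hd, sub_zero])
      (by rw [map_sub, augmentation_boundary, h0, sub_zero])
    exact ⟨cs.homotopy c - y, by rw [map_sub, hy, sub_sub_cancel]⟩

theorem exists_boundary_eq_id {c : SalvettiChain B (ArtinMonoid M)}
    (hd : cs.boundary (MonoidHom.id _) c = 0) (h0 : augmentation B _ c = 0) :
    ∃ y, cs.boundary (MonoidHom.id _) y = c := by
  obtain ⟨p, hp⟩ := (c.support.finite_toSet.image cs.cellWeight).bddAbove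
  exact exists_boundary_eq_of_mem_lowerChains p c
    (fun b hb => Nat.lt_succ_of_le (hp ⟨b, hb, rfl⟩)) hd h0

/-- The Salvetti complex of the Artin group is exact. -/
theorem exists_boundary_eq {c : SalvettiChain B (ArtinGroup M)}
    (hd : cs.boundary (toGroup M) c = 0) (h0 : augmentation B _ c = 0) :
    ∃ y, cs.boundary (toGroup M) y = c := by
  classical
  choose n hn using cs.exists_mul_garside_pow
  set m := c.support.sup fun b => n b.2
  set z := toGroup M ((cs.garside Set.univ ^ 2) ^ m) with hz
  have hι : ∀ a x, toGroup M (MonoidHom.id _ a * x) = toGroup M a * toGroup M x := fun a x =>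
    map_mul _ _ _
  have hinj : Function.Injective (Prod.map (id : Finset B → _) (toGroup M)) :=
    Function.injective_id.prodMap cs.toGroup_injective
  obtain ⟨c', hc'⟩ : ∃ c', Finsupp.mapDomain (Prod.map id (toGroup M)) c' =
      Finsupp.mapDomain (Prod.map id (· * z)) c := by
    refine ⟨_, Finsupp.mapDomain_comapDomain _ hinj _ ?_⟩
    intro b hb
    obtain ⟨⟨J, g⟩, hg, rfl⟩ := Finset.mem_image.mp (Finsupp.mapDomain_support hb)
    obtain ⟨a, ha⟩ := hn g m (Finset.le_sup (f := fun b : Finset B × ArtinGroup M => n b.2) hg)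
    refine ⟨(J, a), ?_⟩
    rw [Prod.map_apply, Prod.map_apply, ← ha, hz]
  obtain ⟨y, hy⟩ := exists_boundary_eq_id (cs := cs) (c := c')
    (Finsupp.mapDomain_injective hinj (by
      rw [← boundary_mapDomain hι, hc', boundary_mapDomain_mul_right, hd, Finsupp.mapDomain_zero,
        Finsupp.mapDomain_zero]))
    (by rw [← augmentation_mapDomain (toGroup M), hc', augmentation_mapDomain, h0])
  refine ⟨Finsupp.mapDomain (Prod.map id (· * z⁻¹))
    (Finsupp.mapDomain (Prod.map id (toGroup M)) y), ?_⟩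
  rw [boundary_mapDomain_mul_right, boundary_mapDomain hι, hy, hc', ← Finsupp.mapDomain_comp]
  convert Finsupp.mapDomain_id
  ext ⟨J, g⟩ <;> simp

end CoxeterSystem

end Contraction

section Resolution

open CategoryTheory

namespace Rep

/-- Group cohomology vanishes in the degrees where some projective resolution vanishes. -/
theorem subsingleton_groupCohomology_of_resolution {k G : Type} [CommRing k] [Group G]
    (X : ℕ → Rep.{0} k G) [∀ i, Projective (X i)] (d : ∀ i, X (i + 1) ⟶ X i)
    (ε : X 0 ⟶ trivial k G k) (hdd : ∀ i, d (i + 1) ≫ d i = 0) (hdε : d 0 ≫ ε = 0)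
    (hε : Function.Surjective ε.hom) (h0 : ∀ x, ε.hom x = 0 → ∃ y, (d 0).hom y = x)
    (hd : ∀ i x, (d i).hom x = 0 → ∃ y, (d (i + 1)).hom y = x) {m : ℕ} [Subsingleton (X m)]
    (A : Rep.{0} k G) : Subsingleton (groupCohomology A m) := by
  let C : ChainComplex (Rep.{0} k G) ℕ := ChainComplex.of X d hdd
  have hC : ∀ i, C.d (i + 1) i = d i := fun i => ChainComplex.of_d X d i
  let π : C ⟶ (ChainComplex.single₀ _).obj (trivial k G k) :=
    (C.toSingle₀Equiv _).symm ⟨ε, by rw [hC]; exact hdε⟩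
  have hπ : QuasiIso π := ⟨fun i => by
    induction i with
    | zero =>
      rw [ChainComplex.quasiIsoAt₀_iff, ShortComplex.quasiIso_iff_of_zeros' _ rfl rfl rfl]
      constructor
      · apply (forget₂ _ (ModuleCat k)).reflects_exact_of_faithful
        rw [ShortComplex.moduleCat_exact_iff]
        intro x hx
        obtain ⟨y, hy⟩ := h0 x (by simpa [π, ChainComplex.toSingle₀Equiv] using! hx)
        exact ⟨y, by rw [← hC] at hy; exact hy⟩
      · rw [Rep.epi_iff_surjective]
        intro x
        obtain ⟨y, hy⟩ := hε x
        exact ⟨y, by simpa [π, ChainComplex.toSingle₀Equiv] using! hy⟩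
    | succ i _ =>
      rw [quasiIsoAt_iff_exactAt' (hL := ChainComplex.exactAt_succ_single_obj ..),
        HomologicalComplex.exactAt_iff' _ (i + 2) (i + 1) i (by simp) (by simp)]
      apply (forget₂ _ (ModuleCat k)).reflects_exact_of_faithful
      rw [ShortComplex.moduleCat_exact_iff]
      intro x hx
      obtain ⟨y, hy⟩ := hd i x (by rw [← hC]; exact hx)
      exact ⟨y, by rw [← hC] at hy; exact hy⟩⟩
  let P : ProjectiveResolution (trivial k G k) :=
    { complex := C
      projective := fun i => inferInstanceAs (Projective (X i))
      π := π }
  have hz : Limits.IsZero (groupCohomology A m) := by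
    refine Limits.IsZero.of_iso ?_ (groupCohomologyIso A m P)
    apply ShortComplex.isZero_homology_of_isZero_X₂
    have : Subsingleton (X m ⟶ A) := ⟨fun f g => by
      apply Rep.hom_ext
      ext x
      rw [Subsingleton.elim x 0, map_zero, map_zero]⟩
    exact ModuleCat.isZero_of_iff_subsingleton.mpr this
  exact ModuleCat.subsingleton_of_isZero hz

end Rep

end Resolution

section UpperBound

open CategoryTheory

variable {B : Type*} {N : Type*}

variable (B N) in
/-- The chains of dimension `k`. -/
def chainsOfDim (k : ℕ) : Submodule ℤ (SalvettiChain B N) :=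
  Finsupp.supported ℤ ℤ {b | b.1.card = k}

theorem single_mem_chainsOfDim {k : ℕ} {b : Finset B × N} (hb : b.1.card = k) :
    Finsupp.single b 1 ∈ chainsOfDim B N k :=
  Finsupp.single_mem_supported ℤ _ hb

variable (B N) in
/-- The projection to the chains of dimension `k`. -/
noncomputable def toChainsOfDim (k : ℕ) : SalvettiChain B N →ₗ[ℤ] chainsOfDim B N k :=
  haveI : DecidablePred (· ∈ {b : Finset B × N | b.1.card = k}) := fun b => decEq b.1.card k
  Finsupp.restrictDom ℤ ℤ _

theorem toChainsOfDim_of_mem {k : ℕ} {c : SalvettiChain B N} (hc : c ∈ chainsOfDim B N k) :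
    toChainsOfDim B N k c = ⟨c, hc⟩ :=
  LinearMap.congr_fun (@Finsupp.restrictDom_comp_subtype _ ℤ ℤ _ _ _
    {b : Finset B × N | b.1.card = k} fun b => decEq b.1.card k) ⟨c, hc⟩

theorem toChainsOfDim_single {k : ℕ} {b : Finset B × N} (hb : b.1.card ≠ k) :
    toChainsOfDim B N k (Finsupp.single b 1) = 0 :=
  Subtype.ext (Finsupp.filter_single_of_neg _ hb)

theorem toChainsOfDim_of_mem_of_ne {k l : ℕ} (hkl : k ≠ l) {c : SalvettiChain B N}
    (hc : c ∈ chainsOfDim B N k) : toChainsOfDim B N l c = 0 := by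
  refine Subtype.ext (Finsupp.filter_eq_zero_iff _ _ |>.mpr fun b hb => ?_)
  by_contra h
  have : b.1.card = k := hc (Finsupp.mem_support_iff.mpr h)
  exact hkl (this.symm.trans hb)

theorem augmentation_eq_zero_of_mem_chainsOfDim [DecidableEq B] {k : ℕ} {c : SalvettiChain B N}
    (hc : c ∈ chainsOfDim B N (k + 1)) : augmentation B N c = 0 := by
  rw [augmentation, Finsupp.linearCombination_apply]
  refine Finset.sum_eq_zero fun b hb => ?_
  have h : b.1.card = k + 1 := hc hb
  have h0 : b.1 ≠ ∅ := fun h0 => by simp [h0] at h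
  simp [h0]

theorem mapDomain_mem_chainsOfDim {N' : Type*} (ψ : N → N') {k : ℕ} {c : SalvettiChain B N}
    (hc : c ∈ chainsOfDim B N k) :
    Finsupp.mapDomain (Prod.map id ψ) c ∈ chainsOfDim B N' k := by
  classical
  intro b hb
  obtain ⟨b', hb', rfl⟩ := Finset.mem_image.mp (Finsupp.mapDomain_support hb)
  exact hc hb'

theorem coe_toChainsOfDim_mapDomain {N' : Type*} (ψ : N → N') (k : ℕ) (c : SalvettiChain B N) :
    (toChainsOfDim B N' k (Finsupp.mapDomain (Prod.map id ψ) c) : SalvettiChain B N') =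
      Finsupp.mapDomain (Prod.map id ψ) (toChainsOfDim B N k c) := by
  suffices h : (chainsOfDim B N' k).subtype ∘ₗ toChainsOfDim B N' k ∘ₗ
      Finsupp.lmapDomain ℤ ℤ (Prod.map id ψ) = Finsupp.lmapDomain ℤ ℤ (Prod.map id ψ) ∘ₗ
        (chainsOfDim B N k).subtype ∘ₗ toChainsOfDim B N k from LinearMap.congr_fun h c
  refine Finsupp.lhom_ext' fun b => LinearMap.ext_ring ?_
  simp only [LinearMap.coe_comp, Function.comp_apply, Finsupp.lsingle_apply,
    Finsupp.lmapDomain_apply, Finsupp.mapDomain_single, Submodule.subtype_apply]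
  by_cases hb : b.1.card = k
  · rw [toChainsOfDim_of_mem (single_mem_chainsOfDim hb),
      toChainsOfDim_of_mem (single_mem_chainsOfDim (b := Prod.map id ψ b) hb)]
    simp
  · rw [toChainsOfDim_single hb, toChainsOfDim_single (b := Prod.map id ψ b) hb]
    simp

namespace CoxeterSystem

variable {W : Type*} [Group W] {M : CoxeterMatrix B} {cs : CoxeterSystem M W} [Finite W]
  [LinearOrder B]

theorem cellBoundary_mem_chainsOfDim [Monoid N] (φ : ArtinMonoid M →* N) {k : ℕ}
    {b : Finset B × N} (hb : b.1.card = k + 1) : cs.cellBoundary φ b ∈ chainsOfDim B N k := by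
  rw [cellBoundary]
  refine Submodule.sum_mem _ fun s hs => Submodule.smul_mem _ _ ?_
  rw [salvettiBlock]
  refine Submodule.sum_mem _ fun x _ => Submodule.smul_mem _ _ (single_mem_chainsOfDim ?_)
  change (b.1.erase s).card = k
  rw [Finset.card_erase_of_mem hs, hb, Nat.add_sub_cancel]

theorem cellBoundary_eq_zero [Monoid N] (φ : ArtinMonoid M →* N) {b : Finset B × N}
    (hb : b.1.card = 0) : cs.cellBoundary φ b = 0 := by
  rw [cellBoundary, Finset.card_eq_zero.mp hb, Finset.sum_empty]

theorem coe_toChainsOfDim_boundary [Monoid N] (φ : ArtinMonoid M →* N) (k : ℕ)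
    (c : SalvettiChain B N) :
    (toChainsOfDim B N k (cs.boundary φ c) : SalvettiChain B N) =
      cs.boundary φ (toChainsOfDim B N (k + 1) c) := by
  suffices h : (chainsOfDim B N k).subtype ∘ₗ toChainsOfDim B N k ∘ₗ cs.boundary φ =
      cs.boundary φ ∘ₗ (chainsOfDim B N (k + 1)).subtype ∘ₗ toChainsOfDim B N (k + 1) from
    LinearMap.congr_fun h c
  refine Finsupp.lhom_ext' fun b => LinearMap.ext_ring ?_
  simp only [LinearMap.coe_comp, Function.comp_apply, Finsupp.lsingle_apply,
    Submodule.subtype_apply, boundary_single]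
  by_cases hb : b.1.card = k + 1
  · rw [toChainsOfDim_of_mem (single_mem_chainsOfDim hb),
      toChainsOfDim_of_mem (cellBoundary_mem_chainsOfDim φ hb), boundary_single]
  · rw [toChainsOfDim_single hb, Submodule.coe_zero, map_zero]
    rcases Nat.eq_zero_or_pos b.1.card with h0 | h0
    · rw [cellBoundary_eq_zero φ h0, map_zero, Submodule.coe_zero]
    · obtain ⟨l, hl⟩ := Nat.exists_eq_succ_of_ne_zero h0.ne'
      rw [toChainsOfDim_of_mem_of_ne (k := l) (by omega) (cellBoundary_mem_chainsOfDim φ hl),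
        Submodule.coe_zero]

end CoxeterSystem

/-- The free representation on a set of orbits, with the group acting on the right by inverses. -/
noncomputable def rightFree (k α G : Type*) [CommRing k] [Group G] :
    Representation k G ((α × G) →₀ k) where
  toFun h := Finsupp.lmapDomain k k (Prod.map id (· * h⁻¹))
  map_one' := by
    refine Finsupp.lhom_ext' fun b => LinearMap.ext_ring ?_
    simp [Prod.map]
  map_mul' g h := by
    refine Finsupp.lhom_ext' fun b => LinearMap.ext_ring ?_
    simp [Prod.map, mul_assoc]

theorem rightFree_apply {k α G : Type*} [CommRing k] [Group G] (h : G) (c : (α × G) →₀ k) :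
    rightFree k α G h c = Finsupp.mapDomain (Prod.map id (· * h⁻¹)) c := rfl

theorem rightFree_apply_single {k α G : Type*} [CommRing k] [Group G] (h : G) (b : α × G) (r : k) :
    rightFree k α G h (Finsupp.single b r) = Finsupp.single (b.1, b.2 * h⁻¹) r := by
  rw [rightFree_apply, Finsupp.mapDomain_single]
  rfl

instance rightFree_projective (k α G : Type) [CommRing k] [Group G] :
    Projective (Rep.of (rightFree k α G)) where
  factors {E X} f e he := by
    have hs := (Rep.epi_iff_surjective e).mp he
    choose σ hσ using hs
    let g : ((α × G) →₀ k) →ₗ[k] E := Finsupp.linearCombination k fun b =>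
      E.ρ b.2⁻¹ (σ (f.hom (Finsupp.single (b.1, 1) (1 : k))))
    have hg : ∀ b, g (Finsupp.single b 1) =
        E.ρ b.2⁻¹ (σ (f.hom (Finsupp.single (b.1, 1) (1 : k)))) := fun b => by
      simp [g]
    refine ⟨Rep.ofHom ⟨g, fun h => ?_⟩, ?_⟩
    · refine Finsupp.lhom_ext' fun b => LinearMap.ext_ring ?_
      simp only [LinearMap.coe_comp, Function.comp_apply, Finsupp.lsingle_apply]
      rw [hg, rightFree_apply_single, hg]
      simp
    · apply Rep.hom_ext
      ext : 1
      refine Finsupp.lhom_ext' fun b => LinearMap.ext_ring ?_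
      change e.hom (g (Finsupp.single b 1)) = f.hom (Finsupp.single b 1)
      rw [hg, Rep.hom_comm_apply, hσ, ← Rep.hom_comm_apply, rightFree_apply_single]
      simp

/-- The action on the Salvetti chains of dimension `k`. -/
noncomputable def chainsAction (B G : Type*) [Group G] (k : ℕ) :
    Representation ℤ G (chainsOfDim B G k) :=
  (rightFree ℤ (Finset B) G).subrepresentation (chainsOfDim B G k) fun _ _ hc =>
    mapDomain_mem_chainsOfDim _ hc

/-- The inclusion of the chains of dimension `k`. -/
noncomputable def chainsInclusion (B G : Type) [Group G] (k : ℕ) :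
    Rep.of (chainsAction B G k) ⟶ Rep.of (rightFree ℤ (Finset B) G) :=
  Rep.ofHom ⟨(chainsOfDim B G k).subtype, fun _ => rfl⟩

/-- The projection to the chains of dimension `k`. -/
noncomputable def chainsProjection (B G : Type) [Group G] (k : ℕ) :
    Rep.of (rightFree ℤ (Finset B) G) ⟶ Rep.of (chainsAction B G k) :=
  Rep.ofHom ⟨toChainsOfDim B G k, fun _ => LinearMap.ext fun c =>
    Subtype.ext (coe_toChainsOfDim_mapDomain _ k c)⟩

theorem chainsInclusion_projection (B G : Type) [Group G] (k : ℕ) :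
    chainsInclusion B G k ≫ chainsProjection B G k = 𝟙 _ := by
  apply Rep.hom_ext
  ext c : 2
  exact toChainsOfDim_of_mem c.2

instance chainsAction_projective (B G : Type) [Group G] (k : ℕ) :
    Projective (Rep.of (chainsAction B G k)) where
  factors f e _ := ⟨chainsInclusion B G k ≫
    Projective.factorThru (chainsProjection B G k ≫ f) e, by
      rw [Category.assoc, Projective.factorThru_comp, ← Category.assoc,
        chainsInclusion_projection, Category.id_comp]⟩

theorem subsingleton_chainsOfDim [Fintype B] {k : ℕ} (hk : Fintype.card B < k) :
    Subsingleton (chainsOfDim B N k) := by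
  refine subsingleton_of_forall_eq 0 fun c => Subtype.ext (Finsupp.ext fun b => ?_)
  by_contra h
  have : b.1.card = k := c.2 (Finsupp.mem_support_iff.mpr h)
  exact absurd b.1.card_le_univ (by omega)

namespace CoxeterSystem

open ArtinMonoid

variable {B W : Type} [Group W] [Finite W] {M : CoxeterMatrix B} (cs : CoxeterSystem M W)
  [LinearOrder B]

/-- The differential of the Salvetti resolution. -/
noncomputable def differential (k : ℕ) : Rep.of (chainsAction B (ArtinGroup M) (k + 1)) ⟶
    Rep.of (chainsAction B (ArtinGroup M) k) :=
  Rep.ofHom ⟨toChainsOfDim B (ArtinGroup M) k ∘ₗ cs.boundary (toGroup M) ∘ₗ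
    (chainsOfDim B (ArtinGroup M) (k + 1)).subtype, fun h => LinearMap.ext fun c => by
      refine Subtype.ext ((congrArg (fun c => (toChainsOfDim B (ArtinGroup M) k c).1)
        (boundary_mapDomain_mul_right (cs := cs) h⁻¹ c.1)).trans ?_)
      exact coe_toChainsOfDim_mapDomain _ k _⟩

theorem coe_differential (k : ℕ) (c : chainsOfDim B (ArtinGroup M) (k + 1)) :
    ((cs.differential k).hom c).1 = cs.boundary (toGroup M) c.1 := by
  refine (coe_toChainsOfDim_boundary (cs := cs) (toGroup M) k c.1).trans ?_
  rw [toChainsOfDim_of_mem c.2]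

variable (M) in
/-- The augmentation of the Salvetti resolution. -/
noncomputable def augmentationHom :
    Rep.of (chainsAction B (ArtinGroup M) 0) ⟶ Rep.trivial ℤ (ArtinGroup M) ℤ :=
  Rep.ofHom ⟨augmentation B (ArtinGroup M) ∘ₗ (chainsOfDim B _ 0).subtype, fun _ =>
    LinearMap.ext fun c => augmentation_mapDomain _ c.1⟩

theorem exists_differential_eq [Finite B] (k : ℕ) (c : chainsOfDim B (ArtinGroup M) k)
    (hd : cs.boundary (toGroup M) c.1 = 0) (h0 : augmentation B _ c.1 = 0) :
    ∃ y, (cs.differential k).hom y = c := by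
  obtain ⟨y, hy⟩ := exists_boundary_eq hd h0
  refine ⟨toChainsOfDim B _ (k + 1) y, Subtype.ext ?_⟩
  rw [coe_differential, ← coe_toChainsOfDim_boundary, hy, toChainsOfDim_of_mem c.2]

theorem boundary_eq_zero_of_mem_chainsOfDim_zero {c : SalvettiChain B (ArtinGroup M)}
    (hc : c ∈ chainsOfDim B (ArtinGroup M) 0) : cs.boundary (toGroup M) c = 0 := by
  rw [boundary, Finsupp.linearCombination_apply]
  refine Finset.sum_eq_zero fun b hb => ?_
  simp [cellBoundary_eq_zero (cs := cs) (toGroup M) (show b.1.card = 0 from hc hb)]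

/-- The cohomology of a spherical Artin group vanishes above its rank. -/
theorem subsingleton_groupCohomology_artinGroup (cs : CoxeterSystem M W) [Fintype B] {m : ℕ}
    (hm : Fintype.card B < m)
    (A : Rep.{0} ℤ (ArtinGroup M)) : Subsingleton (groupCohomology A m) := by
  have : Subsingleton (Rep.of (chainsAction B (ArtinGroup M) m)) := subsingleton_chainsOfDim hm
  refine Rep.subsingleton_groupCohomology_of_resolution
    (fun k => Rep.of (chainsAction B (ArtinGroup M) k)) cs.differential
    (augmentationHom M) (fun k => ?_) ?_ (fun n => ?_) (fun c hc => ?_) (fun k c hc => ?_) A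
  · apply Rep.hom_ext
    ext c : 2
    refine Subtype.ext ((cs.coe_differential k _).trans ?_)
    exact (congrArg (cs.boundary (toGroup M)) (cs.coe_differential (k + 1) c)).trans
      (boundary_boundary _ _)
  · apply Rep.hom_ext
    ext c : 2
    exact (congrArg (augmentation B (ArtinGroup M)) (cs.coe_differential 0 c)).trans
      (augmentation_boundary _ _)
  · refine ⟨n • (⟨Finsupp.single (∅, 1) 1, single_mem_chainsOfDim Finset.card_empty⟩ :
      chainsOfDim B (ArtinGroup M) 0), ?_⟩
    change augmentation B (ArtinGroup M) (n • Finsupp.single (∅, 1) 1) = n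
    rw [map_smul]
    simp
  · exact cs.exists_differential_eq 0 c (cs.boundary_eq_zero_of_mem_chainsOfDim_zero c.2) hc
  · refine cs.exists_differential_eq (k + 1) c ?_ (augmentation_eq_zero_of_mem_chainsOfDim c.2)
    rw [← coe_differential, hc]
    rfl

end CoxeterSystem

end UpperBound

section AbelianClasses

open CategoryTheory

variable {k P : Type} [CommRing k] [Group P]

/-- The cup product of additive characters is a cocycle. -/
theorem d_prod_eq_zero {n : ℕ} (φ : Fin n → P → k) (hφ : ∀ i g h, φ i (g * h) = φ i g + φ i h) :
    inhomogeneousCochains.d (Rep.trivial k P k) n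
      (fun g : Fin n → P => (∏ i, φ i (g i) : k)) = 0 := by
  refine funext fun g => ?_
  let T : ℕ → k := fun j =>
    ∏ i : Fin n, if (i : ℕ) < j then φ i (g i.castSucc) else φ i (g i.succ)
  have h0 : ∏ i, φ i (g i.succ) = T 0 := by simp [T]
  have hlast : ∏ i, φ i (Fin.contractNth (Fin.last n) (· * ·) g i) = T n :=
    Finset.prod_congr rfl fun i _ => by
      rw [Fin.contractNth_apply_of_lt _ _ _ _ (by simp), if_pos i.2]
  have hmid : ∀ j : Fin n, ∏ i, φ i (Fin.contractNth j.castSucc (· * ·) g i) =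
      T j + T (j + 1) := by
    intro j
    refine (Finset.prod_add_prod_eq (Finset.mem_univ j) ?_ (fun i _ hi => ?_)
      fun i _ hi => ?_).symm
    · rw [Fin.contractNth_apply_of_eq _ _ _ _ (by simp), hφ, if_neg (by omega), if_pos (by omega),
        add_comm]
    · rcases lt_or_gt_of_ne (Fin.val_ne_of_ne hi) with h | h
      · rw [Fin.contractNth_apply_of_lt _ _ _ _ (by simpa using h), if_pos h]
      · rw [Fin.contractNth_apply_of_gt _ _ _ _ (by simpa using h), if_neg (by omega)]
    · rcases lt_or_gt_of_ne (Fin.val_ne_of_ne hi) with h | h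
      · rw [Fin.contractNth_apply_of_lt _ _ _ _ (by simpa using h), if_pos (by omega)]
      · rw [Fin.contractNth_apply_of_gt _ _ _ _ (by simpa using h), if_neg (by omega)]
  have htel : ∀ m, ∑ j ∈ Finset.range m, (-1 : k) ^ (j + 1) * (T j + T (j + 1)) =
      (-1) ^ m * T m - T 0 := by
    intro m
    induction m with
    | zero => simp
    | succ m ih =>
      rw [Finset.sum_range_succ, ih]
      ring
  rw [inhomogeneousCochains.d_hom_apply]
  change (∏ i, φ i (g i.succ)) + ∑ j : Fin (n + 1), (-1 : k) ^ ((j : ℕ) + 1) *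
    ∏ i, φ i (Fin.contractNth j (· * ·) g i) = 0
  rw [Fin.sum_univ_castSucc, hlast, h0]
  simp only [hmid, Fin.val_castSucc, Fin.val_last]
  rw [Fin.sum_univ_eq_sum_range fun j => (-1 : k) ^ (j + 1) * (T j + T (j + 1)), htel]
  ring

/-- The alternating sum over the orderings of a commuting family vanishes on coboundaries. -/
theorem sum_sign_mul_d_eq_zero {m : ℕ} (z : Fin (m + 1) → P)
    (hz : ∀ i j, Commute (z i) (z j)) (u : (Fin m → P) → k) :
    ∑ σ : Equiv.Perm (Fin (m + 1)), ((Equiv.Perm.sign σ : ℤ) : k) *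
      (inhomogeneousCochains.d (Rep.trivial k P k) m u (z ∘ σ) : k) = 0 := by
  have hd : ∀ g : Fin (m + 1) → P, (inhomogeneousCochains.d (Rep.trivial k P k) m u g : k) =
      u (g ∘ Fin.succ) + ∑ j : Fin (m + 1), (-1 : k) ^ ((j : ℕ) + 1) *
        u (Fin.contractNth j (· * ·) g) := fun g => inhomogeneousCochains.d_hom_apply _ _ _ _
  have hmid : ∀ j : Fin m, ∑ σ : Equiv.Perm (Fin (m + 1)), ((Equiv.Perm.sign σ : ℤ) : k) *
      u (Fin.contractNth j.castSucc (· * ·) (z ∘ σ)) = 0 := by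
    intro j
    have hne : j.castSucc ≠ j.succ := (Fin.castSucc_lt_succ).ne
    refine Finset.sum_involution (fun σ _ => σ * Equiv.swap j.castSucc j.succ) (fun σ _ => ?_)
      (fun σ _ _ h => ?_) (fun _ _ => Finset.mem_univ _) (fun σ _ => ?_)
    · have : Fin.contractNth j.castSucc (· * ·) (z ∘ ⇑(σ * Equiv.swap j.castSucc j.succ)) =
          Fin.contractNth j.castSucc (· * ·) (z ∘ σ) := by
        funext i
        rcases lt_trichotomy (i : ℕ) j with h | h | h
        · rw [Fin.contractNth_apply_of_lt _ _ _ _ (by simpa using h),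
            Fin.contractNth_apply_of_lt _ _ _ _ (by simpa using h)]
          simp only [Function.comp_apply, Equiv.Perm.mul_apply]
          rw [Equiv.swap_apply_of_ne_of_ne] <;>
          · intro h'
            have := congrArg Fin.val h'
            simp at this
            omega
        · obtain rfl := Fin.ext h
          rw [Fin.contractNth_apply_of_eq _ _ _ _ (by simp),
            Fin.contractNth_apply_of_eq _ _ _ _ (by simp)]
          simp only [Function.comp_apply, Equiv.Perm.mul_apply, Equiv.swap_apply_left,
            Equiv.swap_apply_right]
          exact hz _ _
        · rw [Fin.contractNth_apply_of_gt _ _ _ _ (by simpa using h),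
            Fin.contractNth_apply_of_gt _ _ _ _ (by simpa using h)]
          simp only [Function.comp_apply, Equiv.Perm.mul_apply]
          rw [Equiv.swap_apply_of_ne_of_ne] <;>
          · intro h'
            have := congrArg Fin.val h'
            simp at this
            omega
      rw [this, Equiv.Perm.sign_mul, Equiv.Perm.sign_swap hne]
      simp
    · exact hne (Equiv.swap_eq_one_iff.mp (mul_eq_left.mp h))
    · rw [mul_assoc, Equiv.swap_mul_self, mul_one]
  have hlast : ∀ g : Fin (m + 1) → P, Fin.contractNth (Fin.last m) (· * ·) g =
      g ∘ Fin.castSucc := fun g => funext fun i =>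
    Fin.contractNth_apply_of_lt _ _ _ _ (by simp)
  have hrot : ∑ σ : Equiv.Perm (Fin (m + 1)), ((Equiv.Perm.sign σ : ℤ) : k) *
      u ((z ∘ σ) ∘ Fin.succ) = (-1) ^ m * ∑ σ : Equiv.Perm (Fin (m + 1)),
        ((Equiv.Perm.sign σ : ℤ) : k) * u ((z ∘ σ) ∘ Fin.castSucc) := by
    rw [← Equiv.sum_comp (Equiv.mulRight (finRotate (m + 1))) fun σ : Equiv.Perm (Fin (m + 1)) =>
      ((Equiv.Perm.sign σ : ℤ) : k) * u ((z ∘ σ) ∘ Fin.castSucc), Finset.mul_sum]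
    refine Finset.sum_congr rfl fun σ _ => ?_
    have h : (z ∘ ⇑(σ * finRotate (m + 1))) ∘ Fin.castSucc = (z ∘ σ) ∘ Fin.succ := by
      funext i
      simp [finRotate_apply]
    rw [Equiv.coe_mulRight]
    dsimp only
    rw [h, Equiv.Perm.sign_mul, sign_finRotate]
    simp only [Nat.add_sub_cancel, Units.val_mul, Units.val_pow_eq_pow_val, Units.val_neg,
      Units.val_one, Int.cast_mul, Int.cast_pow, Int.cast_neg, Int.cast_one]
    rw [← mul_assoc, mul_left_comm, ← mul_pow]
    simp
  simp only [hd, mul_add, Finset.sum_add_distrib, Finset.mul_sum]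
  rw [Finset.sum_comm, Fin.sum_univ_castSucc, hrot]
  simp only [mul_left_comm _ ((-1 : k) ^ _), ← Finset.mul_sum, hmid, mul_zero,
    Finset.sum_const_zero, zero_add, hlast, Fin.val_last]
  ring

/-- Additive characters that are independent on a commuting family have a nonzero product. -/
theorem nontrivial_groupCohomology_trivial {n : ℕ} (φ : Fin n → P → k)
    (hφ : ∀ i g h, φ i (g * h) = φ i g + φ i h) (z : Fin n → P)
    (hz : ∀ i j, Commute (z i) (z j)) (hdet : (Matrix.of fun i j => φ j (z i)).det ≠ 0) :
    Nontrivial (groupCohomology (Rep.trivial k P k) n) := by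
  by_contra hN
  rw [not_nontrivial_iff_subsingleton] at hN
  let f : (Fin n → P) → k := fun g => ∏ i, φ i (g i)
  have hf : inhomogeneousCochains.d (Rep.trivial k P k) n f = 0 := d_prod_eq_zero φ hφ
  have hex : (groupCohomology.inhomogeneousCochains (Rep.trivial k P k)).ExactAt n :=
    (HomologicalComplex.exactAt_iff_isZero_homology _ _).mpr
      (ModuleCat.isZero_of_iff_subsingleton.mpr hN)
  have hL : (Matrix.of fun i j => φ j (z i)).det =
      ∑ σ : Equiv.Perm (Fin n), ((Equiv.Perm.sign σ : ℤ) : k) * f (z ∘ σ) := by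
    rw [Matrix.det_apply']
    rfl
  apply hdet
  rw [hL]
  cases n with
  | zero =>
    rw [HomologicalComplex.exactAt_iff' _ 0 0 1 (by simp) (by simp),
      ShortComplex.moduleCat_exact_iff] at hex
    obtain ⟨y, hy⟩ := hex f (by
      change (groupCohomology.inhomogeneousCochains (Rep.trivial k P k)).d 0 1 f = 0
      rw [groupCohomology.inhomogeneousCochains.d_def]; exact hf)
    have hd0 : (groupCohomology.inhomogeneousCochains (Rep.trivial k P k)).d 0 0 = 0 :=
      HomologicalComplex.shape _ _ _ (by simp)
    have : f = 0 := by
      rw [← hy]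
      change (groupCohomology.inhomogeneousCochains (Rep.trivial k P k)).d 0 0 y = 0
      rw [hd0]
      rfl
    simp [this]
  | succ m =>
    rw [HomologicalComplex.exactAt_iff' _ m (m + 1) (m + 2) (by simp) (by simp),
      ShortComplex.moduleCat_exact_iff] at hex
    obtain ⟨u, hu⟩ := hex f (by
      change (groupCohomology.inhomogeneousCochains (Rep.trivial k P k)).d (m + 1) (m + 2) f = 0
      rw [groupCohomology.inhomogeneousCochains.d_def]; exact hf)
    have : inhomogeneousCochains.d (Rep.trivial k P k) m u = f := by
      rw [← groupCohomology.inhomogeneousCochains.d_def]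
      exact hu
    rw [← this]
    exact sum_sign_mul_d_eq_zero z hz u

end AbelianClasses

section LowerBound

open CategoryTheory

namespace CoxeterSystem

open ArtinMonoid

variable {B W : Type*} [Group W] {M : CoxeterMatrix B} (cs : CoxeterSystem M W)

/-- The action of the Artin group on the reflections with integer labels. -/
noncomputable def labelAction : ArtinGroup M →* Equiv.Perm (W × ℤ) :=
  ArtinGroup.lift (cs.reflPerm ℤ) (cs.braidRel_reflPerm ℤ)

/-- The elements of the Artin group that only translate the labels. -/
def labelSubgroup : Subgroup (ArtinGroup M) where
  carrier := {g | ∀ r, ∃ c : ℤ, ∀ a, cs.labelAction g (r, a) = (r, a + c)}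
  one_mem' r := ⟨0, by simp⟩
  mul_mem' {g h} hg hh r := by
    obtain ⟨c, hc⟩ := hg r
    obtain ⟨c', hc'⟩ := hh r
    exact ⟨c' + c, fun a => by rw [map_mul, Equiv.Perm.mul_apply, hc', hc, add_assoc]⟩
  inv_mem' {g} hg r := by
    obtain ⟨c, hc⟩ := hg r
    refine ⟨-c, fun a => ?_⟩
    rw [map_inv, Equiv.Perm.inv_eq_iff_eq, hc, neg_add_cancel_right]

/-- The winding number of an element of the label subgroup around a reflection. -/
noncomputable def winding (r : W) (g : cs.labelSubgroup) : ℤ := (cs.labelAction g (r, 0)).2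

theorem labelAction_apply (g : cs.labelSubgroup) (r : W) (a : ℤ) :
    cs.labelAction g (r, a) = (r, a + cs.winding r g) := by
  obtain ⟨c, hc⟩ := g.2 r
  rw [winding, hc, hc, zero_add]

theorem winding_mul (r : W) (g h : cs.labelSubgroup) :
    cs.winding r (g * h) = cs.winding r g + cs.winding r h := by
  have := cs.labelAction_apply (g * h) r 0
  rw [Subgroup.coe_mul, map_mul, Equiv.Perm.mul_apply, labelAction_apply, labelAction_apply] at this
  simpa [add_comm] using (congrArg Prod.snd this).symm

theorem mem_parabolic_of_mem_rightInvSeq {K : Set B} {ω : List B} (hω : ∀ i ∈ ω, i ∈ K) {r : W}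
    (hr : r ∈ cs.rightInvSeq ω) : r ∈ cs.parabolic K := by
  induction ω with
  | nil => simp at hr
  | cons i ω ih =>
    rw [List.forall_mem_cons] at hω
    rw [rightInvSeq, List.mem_cons] at hr
    rcases hr with rfl | hr
    · have h := cs.wordProd_mem_parabolic hω.2
      exact mul_mem (mul_mem (inv_mem h) (cs.simple_mem_parabolic hω.1)) h
    · exact ih hω.2 hr

variable [Finite W]

open scoped Classical in
theorem labelAction_garside_sq {K : Set B} {ω : List B} (hω : cs.IsReduced ω)
    (h : cs.longest K = cs.wordProd ω) (r : W) (a : ℤ) :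
    cs.labelAction (toGroup M (cs.garside K ^ 2)) (r, a) =
      (r, a + ((cs.rightInvSeq ω).count r +
        (cs.rightInvSeq ω).count (cs.longest K * r * cs.longest K) : ℕ)) := by
  have hw : cs.longest K * (cs.longest K * r * cs.longest K) * cs.longest K = r := by
    rw [mul_assoc, mul_assoc, mul_assoc, longest_mul_self, mul_one, ← mul_assoc,
      longest_mul_self, one_mul]
  rw [labelAction, ArtinGroup.lift_toGroup, garside, h, artinLift_wordProd cs hω, map_pow,
    lift_ofWord, pow_two, Equiv.Perm.mul_apply, prod_map_reflPerm_apply, prod_map_reflPerm_apply,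
    ← h, longest_inv, hw, Nat.cast_add, add_assoc]

theorem garside_sq_mem_labelSubgroup (K : Set B) :
    toGroup M (cs.garside K ^ 2) ∈ cs.labelSubgroup := fun r => by
  classical
  obtain ⟨ω, hω, h⟩ := cs.exists_isReduced (cs.longest K)
  exact ⟨_, cs.labelAction_garside_sq hω h r⟩

/-- The square of the Garside element of a parabolic submonoid, in the label subgroup. -/
noncomputable def fullTwist (K : Set B) : cs.labelSubgroup :=
  ⟨_, cs.garside_sq_mem_labelSubgroup K⟩

open scoped Classical in
theorem winding_fullTwist {K : Set B} {ω : List B} (hω : cs.IsReduced ω)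
    (h : cs.longest K = cs.wordProd ω) (r : W) :
    cs.winding r (cs.fullTwist K) = ((cs.rightInvSeq ω).count r +
      (cs.rightInvSeq ω).count (cs.longest K * r * cs.longest K) : ℕ) := by
  rw [winding, fullTwist, cs.labelAction_garside_sq hω h, zero_add]

theorem winding_fullTwist_of_notMem {K : Set B} {i : B} (hi : i ∉ K) :
    cs.winding (cs.simple i) (cs.fullTwist K) = 0 := by
  classical
  obtain ⟨ω, hω, hK, h⟩ := cs.exists_isReduced_of_mem_parabolic (cs.longest_mem K)
  have hi' : cs.simple i ∉ cs.parabolic K := mt cs.simple_mem_parabolic_iff.mp hi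
  have hl := cs.longest_mem K
  rw [cs.winding_fullTwist hω h, List.count_eq_zero_of_not_mem, List.count_eq_zero_of_not_mem]
  · rfl
  · intro hr
    have := cs.mem_parabolic_of_mem_rightInvSeq hK hr
    rw [Subgroup.mul_mem_cancel_right _ hl, Subgroup.mul_mem_cancel_left _ hl] at this
    exact hi' this
  · exact fun hr => hi' (cs.mem_parabolic_of_mem_rightInvSeq hK hr)

theorem winding_fullTwist_of_mem {K : Set B} {i : B} (hi : i ∈ K) :
    cs.winding (cs.simple i) (cs.fullTwist K) ≠ 0 := by
  classical
  obtain ⟨ω, hω, h⟩ := (isLeftDescent_longest (cs := cs) hi).exists_isReduced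
  rw [cs.winding_fullTwist hω h, Nat.cast_ne_zero]
  have : cs.longest K * cs.simple i * cs.longest K ∈ cs.rightInvSeq (i :: ω) := by
    rw [rightInvSeq, List.mem_cons]
    left
    nth_rw 1 [← longest_inv, h]
    rw [h, wordProd_cons]
    simp [mul_assoc]
  have := List.count_pos_iff.mpr this
  omega

theorem commute_fullTwist {J K : Set B} (hJK : J ⊆ K) :
    Commute (cs.fullTwist J) (cs.fullTwist K) := by
  have key : Commute (cs.garside J) (cs.garside K ^ 2) := by
    obtain ⟨ω, hω, hJ, h⟩ := cs.exists_isReduced_of_mem_parabolic (cs.longest_mem J)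
    rw [garside, h, cs.artinLift_wordProd hω, ← prod_map_atom]
    refine Commute.list_prod_left _ _ fun a ha => ?_
    obtain ⟨i, hi, rfl⟩ := List.mem_map.mp ha
    exact (commute_garside_sq (hJK (hJ i hi))).symm
  exact Subtype.ext ((key.pow_left 2).map (toGroup M)).eq

end CoxeterSystem

/-- The cohomology of a spherical Artin group is nonzero in the degree of its rank. -/
theorem CoxeterSystem.exists_nontrivial_groupCohomology_artinGroup {B W : Type} [Group W]
    [Finite W] [Fintype B] {M : CoxeterMatrix B} (cs : CoxeterSystem M W) :
    ∃ A : Rep.{0} ℤ (ArtinGroup M), Nontrivial (groupCohomology A (Fintype.card B)) := by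
  let e := Fintype.equivFin B
  let K : Fin (Fintype.card B) → Set B := fun j => {i | e i ≤ j}
  have hK : Monotone K := fun _ _ h _ hi => le_trans hi h
  have : Nontrivial (groupCohomology (Rep.trivial ℤ cs.labelSubgroup ℤ) (Fintype.card B)) := by
    refine nontrivial_groupCohomology_trivial (fun j => cs.winding (cs.simple (e.symm j)))
      (fun _ => cs.winding_mul _) (fun j => cs.fullTwist (K j)) (fun i j => ?_) ?_
    · rcases le_total i j with h | h
      · exact cs.commute_fullTwist (hK h)
      · exact (cs.commute_fullTwist (hK h)).symm
    · rw [Matrix.det_of_isLowerTriangular, Finset.prod_ne_zero_iff]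
      · exact fun j _ => cs.winding_fullTwist_of_mem (by simp [K])
      · intro i j h
        exact cs.winding_fullTwist_of_notMem (by simpa [K] using h)
  exact ⟨Rep.coind cs.labelSubgroup.subtype (Rep.trivial ℤ cs.labelSubgroup ℤ),
    (groupCohomology.coindIso (Rep.trivial ℤ cs.labelSubgroup ℤ)
      (Fintype.card B)).toLinearEquiv.toEquiv.nontrivial⟩

end LowerBound

/-- The cohomological dimension of a spherical type Artin group equals its rank. -/
theorem stmt7 {B : Type} [Fintype B] (M : CoxeterMatrix B)
    (hspherical : Finite M.Group) :
    cohomDim (ArtinGroup M) = (Fintype.card B : ℕ∞) := by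
  let _ : LinearOrder B := LinearOrder.lift' (Fintype.equivFin B) (Fintype.equivFin B).injective
  refine le_antisymm (sSup_le ?_)
    (le_sSup ⟨_, rfl, M.toCoxeterSystem.exists_nontrivial_groupCohomology_artinGroup⟩)
  rintro _ ⟨m, rfl, A, hA⟩
  by_contra h
  rw [not_le, Nat.cast_lt] at h
  exact not_subsingleton _ (M.toCoxeterSystem.subsingleton_groupCohomology_artinGroup h A)
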